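/- arXiv:2206.10726 — 9 statements merged into one kernel-verified Lean document; each statement's English description precedes it below -/
import Mathlib

section
/- Let G be a group, κ ∈ G a central element with κ ≠ 1 and κ² = 1, and let g, h ∈ G be such that the conjugacy class of g is {g, κ·g}, the conjugacy class of h is {h, κ·h}, and g·h = κ·h·g. Then N := C_G(g) ∩ C_G(h) is a normal subgroup of G, and the quotient group G/N is isomorphic to (ℤ/2ℤ) × (ℤ/2ℤ). -/
/-- If `κ` is a central involution and every conjugate of `g` is `g` or `κ * g`, then the
centralizer of `g` is the kernel of a homomorphism to `ℤ/2`. -/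
theorem exists_monoidHom_ker_eq_centralizer {G : Type*} [Group G] {κ g : G}
    (hκc : ∀ x : G, κ * x = x * κ) (hκ1 : κ ≠ 1) (hκ2 : κ ^ 2 = 1)
    (hcg : ∀ x : G, x * g * x⁻¹ = g ∨ x * g * x⁻¹ = κ * g) :
    ∃ χ : G →* Multiplicative (ZMod 2), χ.ker = Subgroup.centralizer {g} := by
  classical
  have hne : κ * g ≠ g := by simpa using hκ1
  have hconj (x y : G) : x * y * g * (x * y)⁻¹ = x * (y * g * y⁻¹) * x⁻¹ := by group
  have hκ (x : G) : x * (κ * g) * x⁻¹ = κ * (x * g * x⁻¹) := by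
    rw [← mul_assoc x, ← hκc]
    group
  have hκg : κ * (κ * g) = g := by rw [← mul_assoc, ← sq, hκ2, one_mul]
  refine ⟨MonoidHom.mk' (fun x ↦ if x * g * x⁻¹ = g then 1 else Multiplicative.ofAdd 1) ?_, ?_⟩
  · intro x y
    rw [hconj x y]
    rcases hcg x with hx | hx <;> rcases hcg y with hy | hy <;>
      simp only [hx, hy, hκ, hκg, hne, if_true, if_false] <;> decide
  · ext x
    have h1 : (Multiplicative.ofAdd 1 : Multiplicative (ZMod 2)) ≠ 1 := by decide
    simp only [MonoidHom.mem_ker, MonoidHom.mk'_apply, ite_eq_left_iff, h1, imp_false, not_not,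
      Subgroup.mem_centralizer_singleton_iff, mul_inv_eq_iff_eq_mul]


/-- If `κ` is a central element of order 2 and `g, h` have conjugacy classes
`{g, κ·g}`, `{h, κ·h}` with `g·h = κ·h·g`, then `N = C_G(g) ∩ C_G(h)` is normal
with `G/N ≅ ℤ/2 × ℤ/2`. -/
theorem stmt_0 {G : Type*} [Group G] (κ g h : G)
    (hκc : ∀ x : G, κ * x = x * κ) (hκ1 : κ ≠ 1) (hκ2 : κ ^ 2 = 1)
    (hcg : ∀ x : G, x * g * x⁻¹ = g ∨ x * g * x⁻¹ = κ * g)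
    (hcg' : ∃ x : G, x * g * x⁻¹ = κ * g)
    (hch : ∀ x : G, x * h * x⁻¹ = h ∨ x * h * x⁻¹ = κ * h)
    (hch' : ∃ x : G, x * h * x⁻¹ = κ * h)
    (hgh : g * h = κ * (h * g)) :
    (Subgroup.centralizer {g} ⊓ Subgroup.centralizer {h}).Normal ∧
    ∃ f : G →* Multiplicative (ZMod 2) × Multiplicative (ZMod 2),
      Function.Surjective f ∧
      f.ker = Subgroup.centralizer {g} ⊓ Subgroup.centralizer {h} := by
  obtain ⟨χ, hχ⟩ := exists_monoidHom_ker_eq_centralizer hκc hκ1 hκ2 hcg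
  obtain ⟨ψ, hψ⟩ := exists_monoidHom_ker_eq_centralizer hκc hκ1 hκ2 hch
  refine ⟨hχ ▸ hψ ▸ inferInstance, χ.prod ψ, ?_, by rw [MonoidHom.ker_prod, hχ, hψ]⟩
  have hcomm : g * h ≠ h * g := by simpa [hgh] using hκ1
  have hχg : χ g = 1 := by
    rw [← MonoidHom.mem_ker, hχ, Subgroup.mem_centralizer_singleton_iff]
  have hψh : ψ h = 1 := by
    rw [← MonoidHom.mem_ker, hψ, Subgroup.mem_centralizer_singleton_iff]
  have hχh : χ h ≠ 1 := by
    rw [Ne, ← MonoidHom.mem_ker, hχ, Subgroup.mem_centralizer_singleton_iff]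
    exact hcomm.symm
  have hψg : ψ g ≠ 1 := by
    rw [Ne, ← MonoidHom.mem_ker, hψ, Subgroup.mem_centralizer_singleton_iff]
    exact hcomm
  have hor : ∀ a b : Multiplicative (ZMod 2), b ≠ 1 → a = 1 ∨ a = b := by decide
  rintro ⟨a, b⟩
  rcases hor a _ hχh with rfl | rfl <;> rcases hor b _ hψg with rfl | rfl
  · exact ⟨1, map_one _⟩
  · exact ⟨g, by simp [hχg]⟩
  · exact ⟨h, by simp [hψh]⟩
  · exact ⟨g * h, by simp [hχg, hψh]⟩
end

section
/- Let G be a group, κ ∈ G a central element with κ ≠ 1 and κ² = 1, and let g, h ∈ G be such that the conjugacy class of g is {g, κ·g}, the conjugacy class of h is {h, κ·h}, and g·h = κ·h·g. Then the centralizer of the product g·h is C_G(g·h) = (C_G(g) ∩ C_G(h)) ∪ (G \ (C_G(g) ∪ C_G(h))). -/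
theorem Subgroup.mem_centralizer_singleton_iff_conj_eq {G : Type*} [Group G] {a x : G} :
    x ∈ Subgroup.centralizer {a} ↔ x * a * x⁻¹ = a := by
  rw [Subgroup.mem_centralizer_singleton_iff, mul_inv_eq_iff_eq_mul]

/-- Under the same hypotheses as before, the centralizer of `g·h` is
`(C_G(g) ∩ C_G(h)) ∪ (G \ (C_G(g) ∪ C_G(h)))`. -/
theorem stmt_1 {G : Type*} [Group G] (κ g h : G)
    (hκc : ∀ x : G, κ * x = x * κ) (hκ1 : κ ≠ 1) (hκ2 : κ ^ 2 = 1)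
    (hcg : ∀ x : G, x * g * x⁻¹ = g ∨ x * g * x⁻¹ = κ * g)
    (hcg' : ∃ x : G, x * g * x⁻¹ = κ * g)
    (hch : ∀ x : G, x * h * x⁻¹ = h ∨ x * h * x⁻¹ = κ * h)
    (hch' : ∃ x : G, x * h * x⁻¹ = κ * h)
    (hgh : g * h = κ * (h * g)) :
    (Subgroup.centralizer {g * h} : Set G) =
      ((Subgroup.centralizer {g} : Set G) ∩ (Subgroup.centralizer {h} : Set G)) ∪
        ((Subgroup.centralizer {g} : Set G) ∪ (Subgroup.centralizer {h} : Set G))ᶜ := by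
  ext x
  have hmul : x * (g * h) * x⁻¹ = (x * g * x⁻¹) * (x * h * x⁻¹) := by group
  simp only [Set.mem_union, Set.mem_inter_iff, Set.mem_compl_iff, SetLike.mem_coe,
    Subgroup.mem_centralizer_singleton_iff_conj_eq, hmul]
  rcases hcg x with hg | hg <;> rcases hch x with hh | hh <;> rw [hg, hh]
  · simp
  · have : g * (κ * h) = κ * (g * h) := by rw [← mul_assoc, ← hκc g, mul_assoc]
    simp [this, hκ1]
  · simp [mul_assoc, hκ1]
  · have : κ * g * (κ * h) = g * h := by
      rw [hκc g, mul_assoc, ← mul_assoc κ κ h, ← pow_two, hκ2, one_mul]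
    simp [this, hκ1]
end

section
/- Let G be a group, κ ∈ G a central element with κ ≠ 1 and κ² = 1, and let g, h ∈ G be such that the conjugacy class of g is {g, κ·g}, the conjugacy class of h is {h, κ·h}, and g·h = κ·h·g. Let χ : C_G(g) → kˣ and ψ : C_G(h) → kˣ be group homomorphisms satisfying χ(κ·h²)·ψ(κ·g²) = 1 (note that h² ∈ C_G(g) and g² ∈ C_G(h) under these hypotheses). Then the map C_G(g·h) → kˣ sending x to χ(x)·ψ(x) when x ∈ C_G(g) ∩ C_G(h), and to χ(x·h)·ψ(x·g) when x ∉ C_G(g) ∪ C_G(h), is a well-defined group homomorphism (in the second case x·h ∈ C_G(g) and x·g ∈ C_G(h), and every element of C_G(g·h) falls into exactly one of the two cases). -/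
section PartialExtension

open Classical in
/-- Extension by `1` of a homomorphism on a subgroup to a function on the whole group. -/
noncomputable def extendByOne {G M : Type*} [Group G] [Monoid M] {A : Subgroup G} (χ : A →* M)
    (x : G) : M :=
  if hx : x ∈ A then χ ⟨x, hx⟩ else 1

variable {G M : Type*} [Group G] [Monoid M] {A : Subgroup G} (χ : A →* M)

theorem extendByOne_of_mem {x : G} (hx : x ∈ A) : extendByOne χ x = χ ⟨x, hx⟩ :=
  dif_pos hx

theorem extendByOne_mul {x y : G} (hx : x ∈ A) (hy : y ∈ A) :
    extendByOne χ (x * y) = extendByOne χ x * extendByOne χ y := by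
  rw [extendByOne_of_mem χ hx, extendByOne_of_mem χ hy, extendByOne_of_mem χ (mul_mem hx hy),
    ← map_mul]
  rfl

end PartialExtension

/-- An element outside the centralizer of `g` commutes with `g` up to `κ`, if the conjugates of
`g` are among `g` and `κ * g`. -/
theorem mul_eq_of_notMem_centralizer {G : Type*} [Group G] {κ g : G}
    (hcg : ∀ x : G, x * g * x⁻¹ = g ∨ x * g * x⁻¹ = κ * g) {x : G}
    (hx : x ∉ Subgroup.centralizer {g}) : x * g = κ * (g * x) := by
  rcases hcg x with h | h
  · exact absurd (Subgroup.mem_centralizer_singleton_iff.2 (mul_inv_eq_iff_eq_mul.1 h)) hx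
  · rw [mul_inv_eq_iff_eq_mul.1 h, mul_assoc]

/-- Two elements which both commute with `g` up to the central involution `κ` have a product
which commutes with `g`. -/
theorem mul_mem_centralizer_of_mul_eq {G : Type*} [Group G] {κ g x y : G}
    (hκc : ∀ x : G, κ * x = x * κ) (hκ2 : κ ^ 2 = 1)
    (hx : x * g = κ * (g * x)) (hy : y * g = κ * (g * y)) :
    x * y ∈ Subgroup.centralizer {g} := by
  rw [Subgroup.mem_centralizer_singleton_iff]
  calc x * y * g = x * (κ * (g * y)) := by rw [mul_assoc, hy]
    _ = κ * (x * g) * y := by rw [← mul_assoc x κ, ← hκc x]; simp only [mul_assoc]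
    _ = κ ^ 2 * (g * (x * y)) := by rw [hx, pow_two]; simp only [mul_assoc]
    _ = g * (x * y) := by rw [hκ2, one_mul]

/-- Moving `h` past `y` in `x * h * (y * h)`, when `y` and `h` commute up to `κ`. -/
theorem mul_mul_mul_eq_of_mul_eq {G : Type*} [Group G] {κ h y : G}
    (hκc : ∀ x : G, κ * x = x * κ) (hκ2 : κ ^ 2 = 1)
    (hy : y * h = κ * (h * y)) (x : G) : x * h * (y * h) = x * y * (κ * h ^ 2) := by
  have hyh : h * y = κ * (y * h) := by rw [hy, ← mul_assoc, ← pow_two, hκ2, one_mul]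
  calc x * h * (y * h) = x * (h * y) * h := by simp only [mul_assoc]
    _ = x * (y * κ * h) * h := by rw [hyh, ← hκc y, mul_assoc κ]
    _ = x * y * (κ * h ^ 2) := by simp only [mul_assoc, pow_two]


/-- Given characters `χ` of `C_G(g)` and `ψ` of `C_G(h)` with
`χ(κ·h²)·ψ(κ·g²) = 1`, the piecewise map on `C_G(g·h)` is a well-defined group
homomorphism. -/
theorem stmt_2 {k : Type*} [Field k] [IsAlgClosed k] [CharZero k]
    {G : Type*} [Group G] (κ g h : G)
    (hκc : ∀ x : G, κ * x = x * κ) (hκ1 : κ ≠ 1) (hκ2 : κ ^ 2 = 1)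
    (hcg : ∀ x : G, x * g * x⁻¹ = g ∨ x * g * x⁻¹ = κ * g)
    (hcg' : ∃ x : G, x * g * x⁻¹ = κ * g)
    (hch : ∀ x : G, x * h * x⁻¹ = h ∨ x * h * x⁻¹ = κ * h)
    (hch' : ∃ x : G, x * h * x⁻¹ = κ * h)
    (hgh : g * h = κ * (h * g))
    (χ : ↥(Subgroup.centralizer {g}) →* kˣ)
    (ψ : ↥(Subgroup.centralizer {h}) →* kˣ)
    (hmem₁ : κ * h ^ 2 ∈ Subgroup.centralizer {g})
    (hmem₂ : κ * g ^ 2 ∈ Subgroup.centralizer {h})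
    (hcompat : χ ⟨κ * h ^ 2, hmem₁⟩ * ψ ⟨κ * g ^ 2, hmem₂⟩ = 1) :
    (∀ x ∈ Subgroup.centralizer {g * h},
      (x ∈ Subgroup.centralizer {g} ∧ x ∈ Subgroup.centralizer {h}) ∨
      (x ∉ Subgroup.centralizer {g} ∧ x ∉ Subgroup.centralizer {h})) ∧
    ∃ Φ : ↥(Subgroup.centralizer {g * h}) →* kˣ,
      (∀ (x : G) (hx : x ∈ Subgroup.centralizer {g * h})
          (hxg : x ∈ Subgroup.centralizer {g}) (hxh : x ∈ Subgroup.centralizer {h}),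
        Φ ⟨x, hx⟩ = χ ⟨x, hxg⟩ * ψ ⟨x, hxh⟩) ∧
      (∀ (x : G) (hx : x ∈ Subgroup.centralizer {g * h}),
        x ∉ Subgroup.centralizer {g} → x ∉ Subgroup.centralizer {h} →
        ∃ (h₁ : x * h ∈ Subgroup.centralizer {g}) (h₂ : x * g ∈ Subgroup.centralizer {h}),
          Φ ⟨x, hx⟩ = χ ⟨x * h, h₁⟩ * ψ ⟨x * g, h₂⟩) := by
  classical
  have hhg : h * g = κ * (g * h) := by rw [hgh, ← mul_assoc, ← pow_two, hκ2, one_mul]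
  have comm_g {x : G} : x ∈ Subgroup.centralizer {g} ↔ x * g = g * x :=
    Subgroup.mem_centralizer_singleton_iff
  have comm_h {x : G} : x ∈ Subgroup.centralizer {h} ↔ x * h = h * x :=
    Subgroup.mem_centralizer_singleton_iff
  have mem_iff {x : G} (hx : x ∈ Subgroup.centralizer {g * h}) :
      x ∈ Subgroup.centralizer {g} ↔ x ∈ Subgroup.centralizer {h} := by
    have hx' : x * g * h = g * h * x := by
      rw [mul_assoc]; exact Subgroup.mem_centralizer_singleton_iff.1 hx
    rw [comm_g, comm_h]
    constructor
    · intro hxg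
      rw [hxg, mul_assoc, mul_assoc] at hx'
      exact mul_left_cancel hx'
    · intro hxh
      rw [mul_assoc g, ← hxh, ← mul_assoc] at hx'
      exact mul_right_cancel hx'
  have swap_g {x : G} (hx : x ∉ Subgroup.centralizer {g}) := mul_eq_of_notMem_centralizer hcg hx
  have swap_h {x : G} (hx : x ∉ Subgroup.centralizer {h}) := mul_eq_of_notMem_centralizer hch hx
  have mul_h_mem {x : G} (hx : x ∉ Subgroup.centralizer {g}) :
      x * h ∈ Subgroup.centralizer {g} :=
    mul_mem_centralizer_of_mul_eq hκc hκ2 (swap_g hx) hhg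
  have mul_g_mem {x : G} (hx : x ∉ Subgroup.centralizer {h}) :
      x * g ∈ Subgroup.centralizer {h} :=
    mul_mem_centralizer_of_mul_eq hκc hκ2 (swap_h hx) hgh
  refine ⟨fun x hx ↦ ?_, ?_⟩
  · have := mem_iff hx
    tauto
  let φ : G → kˣ := fun x ↦ if x ∈ Subgroup.centralizer {g}
    then extendByOne χ x * extendByOne ψ x
    else extendByOne χ (x * h) * extendByOne ψ (x * g)
  have φ_pos {x : G} (hx : x ∈ Subgroup.centralizer {g}) :
      φ x = extendByOne χ x * extendByOne ψ x := if_pos hx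
  have φ_neg {x : G} (hx : x ∉ Subgroup.centralizer {g}) :
      φ x = extendByOne χ (x * h) * extendByOne ψ (x * g) := if_neg hx
  have φ_mul {x y : G} (hx : x ∈ Subgroup.centralizer {g * h})
      (hy : y ∈ Subgroup.centralizer {g * h}) : φ (x * y) = φ x * φ y := by
    by_cases hxg : x ∈ Subgroup.centralizer {g} <;> by_cases hyg : y ∈ Subgroup.centralizer {g}
    · rw [φ_pos hxg, φ_pos hyg, φ_pos (mul_mem hxg hyg), extendByOne_mul χ hxg hyg,
        extendByOne_mul ψ ((mem_iff hx).1 hxg) ((mem_iff hy).1 hyg), mul_mul_mul_comm]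
    · have hyh := mt (mem_iff hy).2 hyg
      rw [φ_pos hxg, φ_neg hyg, φ_neg (mt (Subgroup.mul_mem_cancel_left _ hxg).1 hyg),
        mul_assoc x, mul_assoc x, extendByOne_mul χ hxg (mul_h_mem hyg),
        extendByOne_mul ψ ((mem_iff hx).1 hxg) (mul_g_mem hyh), mul_mul_mul_comm]
    · have hxh := mt (mem_iff hx).2 hxg
      have hyh := (mem_iff hy).1 hyg
      rw [φ_neg hxg, φ_pos hyg, φ_neg (mt (Subgroup.mul_mem_cancel_right _ hyg).1 hxg),
        mul_assoc x, mul_assoc x, comm_h.1 hyh, comm_g.1 hyg, ← mul_assoc x, ← mul_assoc x,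
        extendByOne_mul χ (mul_h_mem hxg) hyg, extendByOne_mul ψ (mul_g_mem hxh) hyh,
        mul_mul_mul_comm]
    · have hxh := mt (mem_iff hx).2 hxg
      have hyh := mt (mem_iff hy).2 hyg
      have hxyg := mul_mem_centralizer_of_mul_eq hκc hκ2 (swap_g hxg) (swap_g hyg)
      have hxyh := mul_mem_centralizer_of_mul_eq hκc hκ2 (swap_h hxh) (swap_h hyh)
      rw [φ_neg hxg, φ_neg hyg, φ_pos hxyg, mul_mul_mul_comm,
        ← extendByOne_mul χ (mul_h_mem hxg) (mul_h_mem hyg),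
        ← extendByOne_mul ψ (mul_g_mem hxh) (mul_g_mem hyh),
        mul_mul_mul_eq_of_mul_eq hκc hκ2 (swap_h hyh), mul_mul_mul_eq_of_mul_eq hκc hκ2 (swap_g hyg),
        extendByOne_mul χ hxyg hmem₁, extendByOne_mul ψ hxyh hmem₂, mul_mul_mul_comm,
        extendByOne_of_mem χ hmem₁, extendByOne_of_mem ψ hmem₂, hcompat, mul_one]
  refine ⟨MonoidHom.mk' (fun x ↦ φ x) fun x y ↦ φ_mul x.2 y.2,
    fun x _ hxg hxh ↦ ?_, fun x _ hxg hxh ↦ ⟨mul_h_mem hxg, mul_g_mem hxh, ?_⟩⟩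
  · rw [← extendByOne_of_mem χ, ← extendByOne_of_mem ψ]
    exact φ_pos hxg
  · rw [← extendByOne_of_mem χ, ← extendByOne_of_mem ψ]
    exact φ_neg hxg
end

section
/- Let G be a group, κ ∈ G a central element with κ² = 1, and g ∈ G such that the conjugacy class of g is {g, κ·g}. Fix g₀ ∈ G with g₀ ∉ C_G(g), and let χ : C_G(g) → kˣ be a group homomorphism. Then the map χ̄ : G → kˣ defined by χ̄(x) = χ(x·(g₀⁻¹·x·g₀)) for x ∈ C_G(g) and χ̄(x) = χ(κ)·χ(x²) for x ∉ C_G(g) is a group homomorphism (note that C_G(g) has index 2 in G, so g₀⁻¹·x·g₀ ∈ C_G(g) for x ∈ C_G(g) and x² ∈ C_G(g) for x ∉ C_G(g)); moreover χ̄ does not depend on the choice of g₀ ∉ C_G(g). -/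
/-- The value of a character of a subgroup of index two does not change if its argument is
conjugated by another element outside the subgroup. -/
theorem Subgroup.apply_conj_eq_of_index_eq_two {G A : Type*} [Group G] [CommGroup A]
    {H : Subgroup G} (hH : H.index = 2) (χ : H →* A) {a b x : G} (ha : a ∉ H) (hb : b ∉ H)
    (hax : a⁻¹ * x * a ∈ H) (hbx : b⁻¹ * x * b ∈ H) :
    χ ⟨a⁻¹ * x * a, hax⟩ = χ ⟨b⁻¹ * x * b, hbx⟩ := by
  have ht : a⁻¹ * b ∈ H := by
    rw [Subgroup.mul_mem_iff_of_index_two hH, inv_mem_iff]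
    tauto
  have h : (⟨a⁻¹ * x * a, hax⟩ : H) = ⟨a⁻¹ * b, ht⟩ * ⟨b⁻¹ * x * b, hbx⟩ * ⟨a⁻¹ * b, ht⟩⁻¹ := by
    ext
    simp only [Subgroup.coe_mul, Subgroup.coe_inv]
    group
  rw [h, map_mul, map_mul, map_inv, mul_inv_cancel_comm]

/-- The transfer of a character of a subgroup of index two, twisted by the character of the
quotient which takes the value `c` outside the subgroup. -/
theorem Subgroup.exists_twisted_transfer_of_index_eq_two {G A : Type*} [Group G] [CommGroup A]
    {H : Subgroup G} (hH : H.index = 2) (χ : H →* A) (c : A) (hc : c * c = 1)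
    {a : G} (ha : a ∉ H) :
    ∃ F : G →* A,
      (∀ x ∈ H, ∃ hm : x * (a⁻¹ * x * a) ∈ H, F x = χ ⟨x * (a⁻¹ * x * a), hm⟩) ∧
      (∀ x, x ∉ H → ∃ hm : x ^ 2 ∈ H, F x = c * χ ⟨x ^ 2, hm⟩) := by
  classical
  have hN : H.Normal := Subgroup.normal_of_index_eq_two hH
  have hconj (b : G) {x : G} (hx : x ∈ H) : b⁻¹ * x * b ∈ H := by
    simpa using hN.conj_mem x hx b⁻¹
  have hnorm {x : G} (hx : x ∈ H) : x * (a⁻¹ * x * a) ∈ H := H.mul_mem hx (hconj a hx)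
  have hsq (x : G) : x ^ 2 ∈ H := Subgroup.sq_mem_of_index_two hH x
  have hmul {x y : G} : x * y ∈ H ↔ (x ∈ H ↔ y ∈ H) := Subgroup.mul_mem_iff_of_index_two hH
  have key {x b : G} (hb : b ∉ H) (hx : x ∈ H) :
      χ ⟨x * (a⁻¹ * x * a), hnorm hx⟩ = χ ⟨x, hx⟩ * χ ⟨b⁻¹ * x * b, hconj b hx⟩ := by
    rw [← Subgroup.apply_conj_eq_of_index_eq_two hH χ ha hb (hconj a hx), ← map_mul]
    rfl
  let F (x : G) : A :=
    if hx : x ∈ H then χ ⟨x * (a⁻¹ * x * a), hnorm hx⟩ else c * χ ⟨x ^ 2, hsq x⟩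
  have hF {x : G} (hx : x ∈ H) : F x = χ ⟨x * (a⁻¹ * x * a), hnorm hx⟩ := dif_pos hx
  have hF' {x : G} (hx : x ∉ H) : F x = c * χ ⟨x ^ 2, hsq x⟩ := dif_neg hx
  refine ⟨MonoidHom.mk' F fun x y ↦ ?_, fun x hx ↦ ⟨hnorm hx, hF hx⟩,
    fun x hx ↦ ⟨hsq x, hF' hx⟩⟩
  by_cases hx : x ∈ H <;> by_cases hy : y ∈ H
  · have hxy : x * y ∈ H := H.mul_mem hx hy
    have h₁ : (⟨x * y, hxy⟩ : H) = ⟨x, hx⟩ * ⟨y, hy⟩ := rfl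
    have h₂ : (⟨a⁻¹ * (x * y) * a, hconj a hxy⟩ : H) =
        ⟨a⁻¹ * x * a, hconj a hx⟩ * ⟨a⁻¹ * y * a, hconj a hy⟩ := by
      ext
      simp only [Subgroup.coe_mul]
      group
    rw [hF hx, hF hy, hF hxy, key ha hx, key ha hy, key ha hxy, h₁, h₂, map_mul, map_mul,
      mul_mul_mul_comm]
  · have hxy : x * y ∉ H := by rw [hmul]; tauto
    have hy' : y⁻¹ ∉ H := by rwa [inv_mem_iff]
    have h : (⟨(x * y) ^ 2, hsq _⟩ : H) =
        ⟨x, hx⟩ * ⟨y⁻¹⁻¹ * x * y⁻¹, hconj _ hx⟩ * ⟨y ^ 2, hsq y⟩ := by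
      ext
      simp only [Subgroup.coe_mul]
      simp [pow_two, mul_assoc]
    rw [hF hx, hF' hy, hF' hxy, key hy' hx, h, map_mul, map_mul, mul_left_comm]
  · have hxy : x * y ∉ H := by rw [hmul]; tauto
    have h : (⟨(x * y) ^ 2, hsq _⟩ : H) =
        ⟨x ^ 2, hsq x⟩ * (⟨x⁻¹ * y * x, hconj _ hy⟩ * ⟨y, hy⟩) := by
      ext
      simp only [Subgroup.coe_mul]
      simp [pow_two, mul_assoc]
    rw [hF' hx, hF hy, hF' hxy, key hx hy, h, map_mul, map_mul,
      mul_comm (χ ⟨y, hy⟩) (χ _), mul_assoc c]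
  · have hxy : x * y ∈ H := by rw [hmul]; tauto
    have hx' : x⁻¹ ∉ H := by rwa [inv_mem_iff]
    have h₁ : (⟨x * y, hxy⟩ * ⟨x⁻¹ * (x * y) * x, hconj x hxy⟩ : H) =
        ⟨x⁻¹⁻¹ * y ^ 2 * x⁻¹, hconj _ (hsq y)⟩ * ⟨x ^ 2, hsq x⟩ := by
      ext
      simp only [Subgroup.coe_mul]
      simp [pow_two, mul_assoc]
    have h₂ : (⟨y⁻¹ * y ^ 2 * y, hconj y (hsq y)⟩ : H) = ⟨y ^ 2, hsq y⟩ := by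
      ext
      simp [pow_two]
    rw [hF' hx, hF' hy, hF hxy, key hx hxy, ← map_mul, h₁, map_mul,
      Subgroup.apply_conj_eq_of_index_eq_two hH χ hx' hy _ (hconj y (hsq y)), h₂,
      mul_mul_mul_comm, hc, one_mul, mul_comm]

/-- If the conjugacy class of `g` is `{g, κ * g}` with `κ * g ≠ g`, then the centralizer of `g`
has index two. -/
theorem Subgroup.index_centralizer_singleton_eq_two {G : Type*} [Group G] {κ g a : G}
    (hcg : ∀ x : G, x * g * x⁻¹ = g ∨ x * g * x⁻¹ = κ * g)
    (ha : a ∉ Subgroup.centralizer {g}) : (Subgroup.centralizer {g}).index = 2 := by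
  have hmem (x : G) : x ∈ Subgroup.centralizer {g} ↔ x * g * x⁻¹ = g := by
    rw [Subgroup.mem_centralizer_singleton_iff, mul_inv_eq_iff_eq_mul]
  have hne {x : G} (hx : x ∉ Subgroup.centralizer {g}) : x * g * x⁻¹ = κ * g :=
    (hcg x).resolve_left ((hmem x).not.mp hx)
  have hdiv {x y : G} (hx : x ∉ Subgroup.centralizer {g}) (hy : y ∉ Subgroup.centralizer {g}) :
      x⁻¹ * y ∈ Subgroup.centralizer {g} := by
    rw [hmem]
    calc x⁻¹ * y * g * (x⁻¹ * y)⁻¹ = x⁻¹ * (y * g * y⁻¹) * x := by group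
      _ = x⁻¹ * (x * g * x⁻¹) * x := by rw [hne hx, hne hy]
      _ = g := by group
  refine Subgroup.index_eq_two_iff.mpr ⟨a, fun b ↦ ?_⟩
  by_cases hb : b ∈ Subgroup.centralizer {g}
  · exact Or.inr ⟨hb, fun h ↦ ha ((Subgroup.mul_mem_cancel_left _ hb).mp h)⟩
  · refine Or.inl ⟨?_, hb⟩
    simpa using hdiv (x := b⁻¹) (by rwa [inv_mem_iff]) ha


/-- The character `χ̄` of `G` built from a character `χ` of the index-2 subgroup
`C_G(g)` via `χ̄(x) = χ(x·(g₀⁻¹·x·g₀))` for `x ∈ C_G(g)` and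
`χ̄(x) = χ(κ)·χ(x²)` otherwise, is a group homomorphism independent of the
choice of `g₀ ∉ C_G(g)`. -/
theorem stmt_3 {k : Type*} [Field k] [IsAlgClosed k] [CharZero k]
    {G : Type*} [Group G] (κ g : G)
    (hκc : ∀ x : G, κ * x = x * κ) (hκ2 : κ ^ 2 = 1)
    (hcg : ∀ x : G, x * g * x⁻¹ = g ∨ x * g * x⁻¹ = κ * g)
    (hcg' : ∃ x : G, x * g * x⁻¹ = κ * g)
    (g₀ g₀' : G)
    (hg₀ : g₀ ∉ Subgroup.centralizer {g}) (hg₀' : g₀' ∉ Subgroup.centralizer {g})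
    (χ : ↥(Subgroup.centralizer {g}) →* kˣ)
    (hκmem : κ ∈ Subgroup.centralizer {g}) :
    ∃ F : G →* kˣ,
      (∀ x : G, x ∈ Subgroup.centralizer {g} →
        ∃ hm : x * (g₀⁻¹ * x * g₀) ∈ Subgroup.centralizer {g},
          F x = χ ⟨x * (g₀⁻¹ * x * g₀), hm⟩) ∧
      (∀ x : G, x ∉ Subgroup.centralizer {g} →
        ∃ hm : x ^ 2 ∈ Subgroup.centralizer {g},
          F x = χ ⟨κ, hκmem⟩ * χ ⟨x ^ 2, hm⟩) ∧
      (∀ F' : G →* kˣ,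
        ((∀ x : G, x ∈ Subgroup.centralizer {g} →
            ∃ hm : x * (g₀'⁻¹ * x * g₀') ∈ Subgroup.centralizer {g},
              F' x = χ ⟨x * (g₀'⁻¹ * x * g₀'), hm⟩) ∧
          (∀ x : G, x ∉ Subgroup.centralizer {g} →
            ∃ hm : x ^ 2 ∈ Subgroup.centralizer {g},
              F' x = χ ⟨κ, hκmem⟩ * χ ⟨x ^ 2, hm⟩)) → F' = F) := by
  have hH := Subgroup.index_centralizer_singleton_eq_two hcg hg₀
  have hκ : χ ⟨κ, hκmem⟩ * χ ⟨κ, hκmem⟩ = 1 := by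
    rw [← map_mul, ← map_one χ]
    congr 1
    ext
    simpa [pow_two] using hκ2
  obtain ⟨F, hF, hF'⟩ :=
    Subgroup.exists_twisted_transfer_of_index_eq_two hH χ _ hκ hg₀
  refine ⟨F, hF, hF', fun E ⟨hE, hE'⟩ ↦ MonoidHom.ext fun x ↦ ?_⟩
  by_cases hx : x ∈ Subgroup.centralizer {g}
  · obtain ⟨h₁, hE⟩ := hE x hx
    obtain ⟨h₂, hF⟩ := hF x hx
    have h₁' := (Subgroup.mul_mem_cancel_left _ hx).mp h₁
    have h₂' := (Subgroup.mul_mem_cancel_left _ hx).mp h₂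
    calc E x = χ ⟨x, hx⟩ * χ ⟨g₀'⁻¹ * x * g₀', h₁'⟩ := by rw [hE, ← map_mul]; rfl
      _ = χ ⟨x, hx⟩ * χ ⟨g₀⁻¹ * x * g₀, h₂'⟩ := by
        rw [Subgroup.apply_conj_eq_of_index_eq_two hH χ hg₀' hg₀ h₁' h₂']
      _ = F x := by rw [hF, ← map_mul]; rfl
  · obtain ⟨_, hE'⟩ := hE' x hx
    obtain ⟨_, hF'⟩ := hF' x hx
    rw [hE', hF']
end

section
/- Let θ ≥ 4 be an integer, G a group, κ ∈ G central with κ² = 1, and let g₁, …, g_θ ∈ G be elements such that the conjugacy class of each g_i is {g_i, κ·g_i}, together with group homomorphisms χ_i : C_G(g_i) → kˣ satisfying χ_i(g_i) = −1 and, for all i ≠ j: if |i − j| = 1 then g_i·g_j = κ·g_j·g_i and χ_i(κ·g_j²)·χ_j(κ·g_i²) = 1; if |i − j| ≥ 2 then g_i·g_j = g_j·g_i, χ_i(g_j)·χ_j(g_i) = 1 and χ_i(κ)·χ_j(κ) = 1 (these are the conditions defining a Yetter–Drinfeld module of type α_θ, whose Cartan matrix is of type A_θ). Then χ_i(κ)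 = 1 for every i ∈ {1, …, θ}. -/
/-- For a Yetter–Drinfeld datum of type `α_θ` with `θ ≥ 4`, the central element
`κ` acts trivially: `χ_i(κ) = 1` for all `i`. -/
theorem stmt_4 {k : Type*} [Field k] [IsAlgClosed k] [CharZero k]
    {G : Type*} [Group G] (θ : ℕ) (hθ : 4 ≤ θ)
    (κ : G) (hκc : ∀ x : G, κ * x = x * κ) (hκ2 : κ ^ 2 = 1)
    (g : ℕ → G)
    (χ : (i : ℕ) → ↥(Subgroup.centralizer {g i}) →* kˣ)
    (hconj : ∀ i, 1 ≤ i → i ≤ θ →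
      (∀ x : G, x * g i * x⁻¹ = g i ∨ x * g i * x⁻¹ = κ * g i) ∧
      (∃ x : G, x * g i * x⁻¹ = κ * g i))
    (hself : ∀ i, 1 ≤ i → i ≤ θ →
      ∀ hm : g i ∈ Subgroup.centralizer {g i}, χ i ⟨g i, hm⟩ = -1)
    (hadj : ∀ i j, 1 ≤ i → i ≤ θ → 1 ≤ j → j ≤ θ → Nat.dist i j = 1 →
      g i * g j = κ * (g j * g i) ∧
      ∀ (h₁ : κ * g j ^ 2 ∈ Subgroup.centralizer {g i})
        (h₂ : κ * g i ^ 2 ∈ Subgroup.centralizer {g j}),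
        χ i ⟨κ * g j ^ 2, h₁⟩ * χ j ⟨κ * g i ^ 2, h₂⟩ = 1)
    (hfar : ∀ i j, 1 ≤ i → i ≤ θ → 1 ≤ j → j ≤ θ → 2 ≤ Nat.dist i j →
      g i * g j = g j * g i ∧
      (∀ (h₁ : g j ∈ Subgroup.centralizer {g i})
         (h₂ : g i ∈ Subgroup.centralizer {g j}),
        χ i ⟨g j, h₁⟩ * χ j ⟨g i, h₂⟩ = 1) ∧
      (∀ (h₁ : κ ∈ Subgroup.centralizer {g i})
         (h₂ : κ ∈ Subgroup.centralizer {g j}),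
        χ i ⟨κ, h₁⟩ * χ j ⟨κ, h₂⟩ = 1)) :
    ∀ i, 1 ≤ i → i ≤ θ →
      ∀ hm : κ ∈ Subgroup.centralizer {g i}, χ i ⟨κ, hm⟩ = 1 := by
  have hκ : ∀ a : G, κ ∈ Subgroup.centralizer {a} := fun a =>
    Subgroup.mem_centralizer_singleton_iff.2 (hκc a)
  have dist_of_lt {a b : ℕ} (h : a + 2 ≤ b) : 2 ≤ Nat.dist a b := by
    rw [Nat.dist_eq_sub_of_le (by omega)]; omega
  have h₁ : χ 1 ⟨κ, hκ _⟩ = 1 := by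
    have m₃ : g 3 ∈ Subgroup.centralizer {g 1} := Subgroup.mem_centralizer_singleton_iff.2
      (hfar 1 3 le_rfl (by omega) (by omega) (by omega) (dist_of_lt (by omega))).1.symm
    have m₄ : g 4 ∈ Subgroup.centralizer {g 1} := Subgroup.mem_centralizer_singleton_iff.2
      (hfar 1 4 le_rfl (by omega) (by omega) (by omega) (dist_of_lt (by omega))).1.symm
    have h := (hadj 3 4 (by omega) (by omega) (by omega) hθ (by decide)).1
    have e : (⟨g 3, m₃⟩ * ⟨g 4, m₄⟩ : ↥(Subgroup.centralizer {g 1})) =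
        ⟨κ, hκ _⟩ * (⟨g 4, m₄⟩ * ⟨g 3, m₃⟩) := Subtype.ext h
    have e' := congrArg (χ 1) e
    simp only [map_mul] at e'
    rw [mul_comm (χ 1 ⟨g 4, m₄⟩)] at e'
    exact mul_eq_right.1 e'.symm
  have h_far : ∀ j, 3 ≤ j → j ≤ θ → χ j ⟨κ, hκ _⟩ = 1 := by
    intro j hj hjθ
    have h := (hfar 1 j le_rfl (by omega) (by omega) hjθ (dist_of_lt (by omega))).2.2
      (hκ _) (hκ _)
    rwa [h₁, one_mul] at h
  have h₂ : χ 2 ⟨κ, hκ _⟩ = 1 := by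
    have h := (hfar 2 4 (by omega) (by omega) (by omega) hθ (dist_of_lt (by omega))).2.2
      (hκ _) (hκ _)
    rwa [h_far 4 (by omega) hθ, mul_one] at h
  intro i hi hiθ _
  obtain rfl | rfl | h : i = 1 ∨ i = 2 ∨ 3 ≤ i := by omega
  · exact h₁
  · exact h₂
  · exact h_far i h hiθ
end

section
/- Let θ ≥ 5 be an integer, G a group, κ ∈ G central with κ² = 1. Let g₁, …, g_{θ−1} ∈ G have conjugacy classes {g_i, κ·g_i}, let g_θ ∈ G be central, and let χ_i : C_G(g_i) → kˣ (i ≤ θ−1) and χ_θ : G → kˣ be group homomorphisms with χ_i(g_i) = −1 for all i, satisfying: for i ≠ j ≤ θ−1, if |i − j| = 1 then g_i·g_j = κ·g_j·g_i and χ_i(κ·g_j²)·χ_j(κ·g_i²) = 1, while if |i − j| ≥ 2 then g_i·g_j = g_j·g_i, χ_i(g_j)·χ_j(g_i) = 1 and χ_i(κ)·χ_j(κ) = 1; furthermore χ_i(g_θ)·χ_θ(g_i) = 1 for all i ≤ θ−2, and χ_{θ−1}(g_θ)·χ_θ(g_{θ−1}) = −1 (these are the conditions defining a Yetter–Drinfeld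 module of type γ_θ). Then χ_i(κ) = 1 for every i ∈ {1, …, θ}. -/
/-- A homomorphism to a commutative group kills `z` whenever `x * y = z * (y * x)`. -/
theorem map_eq_one_of_eq_mul_swap {H A : Type*} [Group H] [CommGroup A] (f : H →* A)
    {x y z : H} (h : x * y = z * (y * x)) : f z = 1 := by
  have hf := congrArg f h
  rw [map_mul, map_mul, map_mul, mul_comm (f x)] at hf
  exact right_eq_mul.1 hf


/-- For a Yetter–Drinfeld datum of type `γ_θ` with `θ ≥ 5`, the central element
`κ` acts trivially: `χ_i(κ) = 1` for all `i ∈ {1,…,θ}`. -/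
theorem stmt_5 {k : Type*} [Field k] [IsAlgClosed k] [CharZero k]
    {G : Type*} [Group G] (θ : ℕ) (hθ : 5 ≤ θ)
    (κ : G) (hκc : ∀ x : G, κ * x = x * κ) (hκ2 : κ ^ 2 = 1)
    (g : ℕ → G) (hgθc : ∀ x : G, g θ * x = x * g θ)
    (χ : (i : ℕ) → ↥(Subgroup.centralizer {g i}) →* kˣ)
    (χθ : G →* kˣ)
    (hconj : ∀ i, 1 ≤ i → i ≤ θ - 1 →
      (∀ x : G, x * g i * x⁻¹ = g i ∨ x * g i * x⁻¹ = κ * g i) ∧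
      (∃ x : G, x * g i * x⁻¹ = κ * g i))
    (hself : ∀ i, 1 ≤ i → i ≤ θ - 1 →
      ∀ hm : g i ∈ Subgroup.centralizer {g i}, χ i ⟨g i, hm⟩ = -1)
    (hselfθ : χθ (g θ) = -1)
    (hadj : ∀ i j, 1 ≤ i → i ≤ θ - 1 → 1 ≤ j → j ≤ θ - 1 → Nat.dist i j = 1 →
      g i * g j = κ * (g j * g i) ∧
      ∀ (h₁ : κ * g j ^ 2 ∈ Subgroup.centralizer {g i})
        (h₂ : κ * g i ^ 2 ∈ Subgroup.centralizer {g j}),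
        χ i ⟨κ * g j ^ 2, h₁⟩ * χ j ⟨κ * g i ^ 2, h₂⟩ = 1)
    (hfar : ∀ i j, 1 ≤ i → i ≤ θ - 1 → 1 ≤ j → j ≤ θ - 1 → 2 ≤ Nat.dist i j →
      g i * g j = g j * g i ∧
      (∀ (h₁ : g j ∈ Subgroup.centralizer {g i})
         (h₂ : g i ∈ Subgroup.centralizer {g j}),
        χ i ⟨g j, h₁⟩ * χ j ⟨g i, h₂⟩ = 1) ∧
      (∀ (h₁ : κ ∈ Subgroup.centralizer {g i})
         (h₂ : κ ∈ Subgroup.centralizer {g j}),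
        χ i ⟨κ, h₁⟩ * χ j ⟨κ, h₂⟩ = 1))
    (hmix : ∀ i, 1 ≤ i → i ≤ θ - 2 →
      ∀ hm : g θ ∈ Subgroup.centralizer {g i},
        χ i ⟨g θ, hm⟩ * χθ (g i) = 1)
    (hlast : ∀ hm : g θ ∈ Subgroup.centralizer {g (θ - 1)},
      χ (θ - 1) ⟨g θ, hm⟩ * χθ (g (θ - 1)) = -1) :
    (∀ i, 1 ≤ i → i ≤ θ - 1 →
      ∀ hm : κ ∈ Subgroup.centralizer {g i}, χ i ⟨κ, hm⟩ = 1) ∧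
    χθ κ = 1 := by
  have hκmem : ∀ i, κ ∈ Subgroup.centralizer {g i} := fun i =>
    Subgroup.mem_centralizer_singleton_iff.2 (hκc (g i))
  have hmem : ∀ i j, 1 ≤ i → i ≤ θ - 1 → 1 ≤ j → j ≤ θ - 1 → 2 ≤ Nat.dist i j →
      g j ∈ Subgroup.centralizer {g i} := fun i j hi hi' hj hj' hij =>
    Subgroup.mem_centralizer_singleton_iff.2 (hfar i j hi hi' hj hj' hij).1.symm
  -- `κ` is the commutator of `g 3` and `g 4`, both of which centralize `g 1`.
  have h_one : χ 1 ⟨κ, hκmem 1⟩ = 1 :=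
    map_eq_one_of_eq_mul_swap (χ 1)
      (x := ⟨g 3, hmem 1 3 (by lia) (by lia) (by lia) (by lia) (by decide)⟩)
      (y := ⟨g 4, hmem 1 4 (by lia) (by lia) (by lia) (by lia) (by decide)⟩)
      (Subtype.ext (hadj 3 4 (by lia) (by lia) (by lia) (by lia) (by decide)).1)
  have h_transfer : ∀ i j, 1 ≤ i → i ≤ θ - 1 → 1 ≤ j → j ≤ θ - 1 → 2 ≤ Nat.dist i j →
      χ i ⟨κ, hκmem i⟩ = 1 → χ j ⟨κ, hκmem j⟩ = 1 := by
    intro i j hi hi' hj hj' hij h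
    simpa [h] using (hfar i j hi hi' hj hj' hij).2.2 (hκmem i) (hκmem j)
  have h_ge_three : ∀ i, 3 ≤ i → i ≤ θ - 1 → χ i ⟨κ, hκmem i⟩ = 1 := fun i hi hi' =>
    h_transfer 1 i (by lia) (by lia) (by lia) hi' (by unfold Nat.dist; lia) h_one
  refine ⟨fun i hi hi' _ => ?_, ?_⟩
  · obtain rfl | rfl | h : i = 1 ∨ i = 2 ∨ 3 ≤ i := by lia
    · exact h_one
    · exact h_transfer 4 2 (by lia) (by lia) (by lia) hi' (by decide)
        (h_ge_three 4 (by lia) (by lia))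
    · exact h_ge_three i h hi'
  · exact map_eq_one_of_eq_mul_swap χθ
      (hadj 1 2 (by lia) (by lia) (by lia) (by lia) (by decide)).1
end

section
/- Let G be a group, κ ∈ G central with κ ≠ 1 and κ² = 1, and g₁, g₂ ∈ G with conjugacy classes {g₁, κ·g₁} and {g₂, κ·g₂} respectively, such that g₁·g₂ = κ·g₂·g₁ and G is generated by g₁ and g₂. Let χ₁ : C_G(g₁) → kˣ and χ₂ : C_G(g₂) → kˣ be group homomorphisms with χ₁(g₁) = χ₂(g₂) = −1 and χ₁(κ·g₂²)·χ₂(κ·g₁²) = 1 (the conditions defining a Yetter–Drinfeld module of type α₂ whose support generates G). Then there exists a 2-cocycle σ on G with values in kˣ such that σ(g_i, κ)·σ(κ, g_i)⁻¹·χ_i(κ) = 1 for i = 1, 2 (equivalently, the twisted characters χ_i^σ satisfy χ_i^σ(κ) = 1). -/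
open scoped commutatorElement IsMulCommutative

/-- The factor set of a central extension, pushed forward along a homomorphism from
the centre, is a 2-cocycle whose antisymmetrization computes commutators. -/
theorem exists_cocycle_of_central_extension {E G Q : Type*} [Group E] [Group G] [CommGroup Q]
    (p : E →* G) (hp : Function.Surjective p) (hker : p.ker ≤ Subgroup.center E)
    (ψ : Subgroup.center E →* Q) :
    ∃ σ : G → G → Q,
      (∀ a b c : G, σ a b * σ (a * b) c = σ a (b * c) * σ b c) ∧
      ∀ (u v : E) (c : Subgroup.center E), p c = 1 → u * v = c * (v * u) →
        σ (p u) (p v) = ψ c * σ (p v) (p u) := by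
  choose s hs using hp
  have hcomm (z : Subgroup.center E) (e : E) : e * z = z * e :=
    Subgroup.mem_center_iff.mp z.2 e
  have hr (a b : G) : ∃ r : Subgroup.center E, s a * s b = r * s (a * b) := by
    refine ⟨⟨s a * s b * (s (a * b))⁻¹, hker ?_⟩, by simp⟩
    simp [MonoidHom.mem_ker, hs]
  choose r hr using hr
  have hsec (u : E) : ∃ t : Subgroup.center E, s (p u) = t * u := by
    refine ⟨⟨s (p u) * u⁻¹, hker ?_⟩, by simp⟩
    simp [MonoidHom.mem_ker, hs]
  refine ⟨fun a b => ψ (r a b), fun a b c => ?_, fun u v c hc huv => ?_⟩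
  · rw [← map_mul, ← map_mul]
    congr 1
    apply Subtype.ext
    have h : (r a b * r (a * b) c : E) * s (a * b * c) =
        (r a (b * c) * r b c) * s (a * b * c) :=
      calc (r a b * r (a * b) c : E) * s (a * b * c)
          = r a b * s (a * b) * s c := by rw [mul_assoc, ← hr, mul_assoc]
        _ = s a * (s b * s c) := by rw [← hr, mul_assoc]
        _ = s a * r b c * s (b * c) := by rw [hr b c, mul_assoc]
        _ = r b c * (s a * s (b * c)) := by rw [hcomm, mul_assoc]
        _ = r b c * r a (b * c) * s (a * b * c) := by rw [hr a, mul_assoc, mul_assoc]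
        _ = (r a (b * c) * r b c) * s (a * b * c) := by rw [hcomm]
    exact mul_right_cancel h
  · dsimp only
    rw [← map_mul]
    congr 1
    apply Subtype.ext
    have hpp : p u * p v = p v * p u := by
      rw [← map_mul, huv, map_mul, hc, one_mul, map_mul]
    obtain ⟨t, ht⟩ := hsec u
    obtain ⟨t', ht'⟩ := hsec v
    have h : (r (p u) (p v) : E) * s (p u * p v) = (c * r (p v) (p u)) * s (p u * p v) :=
      calc (r (p u) (p v) : E) * s (p u * p v)
          = t * u * (t' * v) := by rw [← hr, ht, ht']
        _ = t * t' * (u * v) := by rw [mul_assoc, ← mul_assoc u, hcomm]; simp only [mul_assoc]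
        _ = t * t' * c * (v * u) := by rw [huv]; simp only [mul_assoc]
        _ = c * (t' * v * (t * u)) := by
            rw [hcomm c, mul_assoc (t' : E), ← mul_assoc v, hcomm t v, hcomm t' t]
            simp only [mul_assoc]
        _ = c * r (p v) (p u) * s (p u * p v) := by rw [← ht, ← ht', hr, hpp, mul_assoc]
    exact mul_right_cancel h

/-- The elements of `E` over the centralizer of `p a` whose commutator with `a` is prescribed by
the character `χ`. -/
def twistedCentralizer {E G Q : Type*} [Group E] [Group G] [CommGroup Q]
    (p : E →* G) (ι : Q →* E) (hι : ∀ (c : Q) (e : E), e * ι c = ι c * e)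
    (a : E) (χ : Subgroup.centralizer {p a} →* Q) : Subgroup E where
  carrier := {e | ∃ h : p e ∈ Subgroup.centralizer {p a}, e * a = ι (χ ⟨p e, h⟩) * (a * e)}
  one_mem' := ⟨by rw [map_one]; exact one_mem _, by
    have : (⟨p 1, by rw [map_one]; exact one_mem _⟩ : Subgroup.centralizer {p a}) = 1 :=
      Subtype.ext (map_one p)
    rw [this]; simp⟩
  mul_mem' := by
    rintro x y ⟨hx, hx'⟩ ⟨hy, hy'⟩
    refine ⟨by rw [map_mul]; exact mul_mem hx hy, ?_⟩
    have : (⟨p (x * y), by rw [map_mul]; exact mul_mem hx hy⟩ : Subgroup.centralizer {p a}) =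
      ⟨p x, hx⟩ * ⟨p y, hy⟩ := Subtype.ext (map_mul p x y)
    rw [this, map_mul, map_mul]
    calc x * y * a = x * ι (χ ⟨p y, hy⟩) * (a * y) := by rw [mul_assoc, hy', mul_assoc]
      _ = ι (χ ⟨p y, hy⟩) * (x * a) * y := by rw [hι]; simp only [mul_assoc]
      _ = ι (χ ⟨p x, hx⟩) * ι (χ ⟨p y, hy⟩) * (a * (x * y)) := by
        rw [hx', ← mul_assoc (ι _), hι]; simp only [mul_assoc]
  inv_mem' := by
    rintro x ⟨hx, hx'⟩
    refine ⟨by rw [map_inv]; exact inv_mem hx, ?_⟩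
    have : (⟨p x⁻¹, by rw [map_inv]; exact inv_mem hx⟩ : Subgroup.centralizer {p a}) =
      ⟨p x, hx⟩⁻¹ := Subtype.ext (map_inv p x)
    rw [this, map_inv, map_inv, eq_inv_mul_iff_mul_eq, ← mul_assoc, ← hι, mul_assoc,
      inv_mul_eq_iff_eq_mul, ← mul_assoc, hx', mul_assoc, mul_assoc a, mul_inv_cancel, mul_one]

/-- Membership in `twistedCentralizer` in terms of the value of the character. -/
theorem mem_twistedCentralizer_of_eq {E G Q : Type*} [Group E] [Group G] [CommGroup Q]
    {p : E →* G} {ι : Q →* E} {hι : ∀ (c : Q) (e : E), e * ι c = ι c * e}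
    {a : E} {χ : Subgroup.centralizer {p a} →* Q} {e : E} {g : G}
    (hg : g ∈ Subgroup.centralizer {p a}) (hpe : p e = g) (h : e * a = ι (χ ⟨g, hg⟩) * (a * e)) :
    e ∈ twistedCentralizer p ι hι a χ := by
  subst hpe
  exact ⟨hg, h⟩

theorem Commute.of_zpow_of_odd {G : Type*} [Group G] {a b : G} {n : ℤ} (hn : Odd n)
    (h : Commute a (b ^ n)) (h2 : Commute a (b ^ 2)) : Commute a b := by
  obtain ⟨m, rfl⟩ := hn
  have h3 : b = ((b ^ 2) ^ m)⁻¹ * b ^ (2 * m + 1) := by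
    rw [zpow_add, zpow_mul]; simp
  rw [h3]
  exact (h2.zpow_right m).inv_right.mul_right h

open Subgroup in
/-- An extension of `G` generated by two elements and central scalars is central, as soon as the
squares and the commutator of the generators satisfy the commutation rules of two characters. -/
theorem ker_le_center_of_twistedCentralizer {E G Q : Type*} [Group E] [Group G] [CommGroup Q]
    (p : E →* G) (ι : Q →* E) (hι : ∀ (c : Q) (e : E), e * ι c = ι c * e)
    (hpι : ∀ c, p (ι c) = 1) (a b : E) (hgen : closure ({a, b} ∪ Set.range ι) = ⊤)
    (χ₁ : centralizer {p a} →* Q) (χ₂ : centralizer {p b} →* Q)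
    (hab : ¬ Commute (p a) (p b))
    (ha : a ^ 2 ∈ twistedCentralizer p ι hι a χ₁ ⊓ twistedCentralizer p ι hι b χ₂)
    (hb : b ^ 2 ∈ twistedCentralizer p ι hι a χ₁ ⊓ twistedCentralizer p ι hι b χ₂)
    (hc : ⁅a, b⁆ ∈ twistedCentralizer p ι hι a χ₁ ⊓ twistedCentralizer p ι hι b χ₂) :
    p.ker ≤ center E := by
  set S := twistedCentralizer p ι hι a χ₁ ⊓ twistedCentralizer p ι hι b χ₂ with hS
  have hιS (c : Q) : ι c ∈ S :=
    ⟨mem_twistedCentralizer_of_eq (one_mem _) (hpι c) (by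
        rw [show (⟨1, one_mem _⟩ : centralizer {p a}) = 1 from rfl]; simp [hι]),
      mem_twistedCentralizer_of_eq (one_mem _) (hpι c) (by
        rw [show (⟨1, one_mem _⟩ : centralizer {p b}) = 1 from rfl]; simp [hι])⟩
  have hcomm (n : E) (hn : n ∈ S) (e : E) : ∃ c, n * e = ι c * (e * n) := by
    have he : e ∈ closure ({a, b} ∪ Set.range ι) := hgen ▸ mem_top e
    induction he using closure_induction with
    | mem x hx =>
      rcases hx with (rfl | rfl) | ⟨c, rfl⟩
      · exact ⟨_, hn.1.choose_spec⟩
      · exact ⟨_, hn.2.choose_spec⟩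
      · exact ⟨1, by simp [hι]⟩
    | one => exact ⟨1, by simp⟩
    | mul x y _ _ hx hy =>
      obtain ⟨c, hc⟩ := hx
      obtain ⟨d, hd⟩ := hy
      refine ⟨c * d, ?_⟩
      rw [← mul_assoc, hc, mul_assoc, mul_assoc, hd, ← mul_assoc x, hι, map_mul]
      simp only [mul_assoc]
    | inv x _ hx =>
      obtain ⟨c, hc⟩ := hx
      refine ⟨c⁻¹, ?_⟩
      rw [map_inv, eq_inv_mul_iff_mul_eq, eq_inv_mul_iff_mul_eq, ← mul_assoc, ← mul_assoc, hι,
        mul_assoc (ι c), mul_assoc, mul_assoc, ← mul_assoc x, ← mul_assoc (ι c), ← hc,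
        mul_inv_cancel_right]
  have hnormal : S.Normal := ⟨fun n hn e => by
    obtain ⟨c, hc⟩ := hcomm n hn e
    have : e * n * e⁻¹ = ι c⁻¹ * n := by
      rw [map_inv, eq_inv_mul_iff_mul_eq, ← mul_assoc, ← hc, mul_inv_cancel_right]
    rw [this]
    exact mul_mem (hιS _) hn⟩
  have hq : Commute (a : E ⧸ S) (b : E ⧸ S) := by
    rw [← commutatorElement_eq_one_iff_commute]
    exact (QuotientGroup.eq_one_iff (⁅a, b⁆)).mpr hc
  have hform (e : E) : ∃ i j : ℤ, (e : E ⧸ S) = (a : E ⧸ S) ^ i * (b : E ⧸ S) ^ j := by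
    have he : e ∈ closure ({a, b} ∪ Set.range ι) := hgen ▸ mem_top e
    induction he using closure_induction with
    | mem x hx =>
      rcases hx with (rfl | rfl) | ⟨c, rfl⟩
      · exact ⟨1, 0, by simp⟩
      · exact ⟨0, 1, by simp⟩
      · exact ⟨0, 0, by simpa using hιS c⟩
    | one => exact ⟨0, 0, by simp⟩
    | mul x y _ _ hx hy =>
      obtain ⟨i, j, h⟩ := hx
      obtain ⟨i', j', h'⟩ := hy
      refine ⟨i + i', j + j', ?_⟩
      rw [QuotientGroup.mk_mul, h, h', zpow_add, zpow_add,
        (hq.zpow_zpow i' j).symm.mul_mul_mul_comm]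
    | inv x _ hx =>
      obtain ⟨i, j, h⟩ := hx
      refine ⟨-i, -j, ?_⟩
      rw [QuotientGroup.mk_inv, h, mul_inv_rev, zpow_neg, zpow_neg, ← mul_inv_rev, ← mul_inv_rev,
        (hq.zpow_zpow i j).eq]
  have hpS {s : E} (hs : s ∈ S) : Commute (p a) (p s) ∧ Commute (p b) (p s) :=
    ⟨(mem_centralizer_singleton_iff.mp hs.1.choose).symm,
      (mem_centralizer_singleton_iff.mp hs.2.choose).symm⟩
  intro e he
  have heS : e ∈ S := by
    obtain ⟨i, j, h⟩ := hform e
    rw [← QuotientGroup.mk_zpow, ← QuotientGroup.mk_zpow, ← QuotientGroup.mk_mul,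
      QuotientGroup.eq] at h
    have hps := hpS h
    rw [map_mul, map_inv, MonoidHom.mem_ker.mp he, inv_one, one_mul, map_mul, map_zpow,
      map_zpow] at hps
    have hpa2 := hpS ha
    have hpb2 := hpS hb
    rw [map_pow] at hpa2 hpb2
    have hj : Even j := by
      by_contra hj
      refine hab (Commute.of_zpow_of_odd (Int.not_even_iff_odd.mp hj) ?_ hpb2.1)
      have := ((Commute.refl (p a)).zpow_right i).inv_right.mul_right hps.1
      rwa [inv_mul_cancel_left] at this
    have hi : Even i := by
      by_contra hi
      refine hab (Commute.of_zpow_of_odd (Int.not_even_iff_odd.mp hi) ?_ hpa2.2).symm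
      have := hps.2.mul_right ((Commute.refl (p b)).zpow_right j).inv_right
      rwa [mul_inv_cancel_right] at this
    have hm : a ^ i * b ^ j ∈ S := by
      rw [even_iff_two_dvd] at hi hj
      obtain ⟨i, rfl⟩ := hi
      obtain ⟨j, rfl⟩ := hj
      rw [zpow_mul, zpow_mul]
      exact mul_mem (zpow_mem (by exact_mod_cast ha) i) (zpow_mem (by exact_mod_cast hb) j)
    have := mul_mem hm (inv_mem h)
    simpa [mul_assoc] using this
  have hone {x : E} {χ : centralizer {p x} →* Q} (h : e ∈ twistedCentralizer p ι hι x χ) :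
      Commute e x := by
    obtain ⟨h, h'⟩ := h
    have h1 : (⟨p e, h⟩ : centralizer {p x}) = 1 := Subtype.ext (MonoidHom.mem_ker.mp he)
    rw [h1, map_one, map_one, one_mul] at h'
    exact h'
  have hle : closure ({a, b} ∪ Set.range ι) ≤ centralizer {e} := by
    rw [closure_le]
    rintro x ((rfl | rfl) | ⟨c, rfl⟩)
    · exact mem_centralizer_singleton_iff.mpr (hone heS.1).symm.eq
    · exact mem_centralizer_singleton_iff.mpr (hone heS.2).symm.eq
    · exact mem_centralizer_singleton_iff.mpr (hι c e).symm
  rw [mem_center_iff]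
  intro x
  exact mem_centralizer_singleton_iff.mp (hle (hgen ▸ mem_top x))

/-- Monomial permutations of `ℤ × ℤ × Q` realizing a two-generated group of nilpotency class three
with prescribed scalar commutators. -/
theorem exists_perm_commutator_relations {Q : Type*} [CommGroup Q] (ζ ε₁ ε₂ : Q)
    (h₁ : ε₁ ^ 2 = 1) (h₂ : ε₂ ^ 2 = 1) :
    ∃ (x y : Equiv.Perm (ℤ × ℤ × Q)) (ι : Q →* Equiv.Perm (ℤ × ℤ × Q)),
      Function.Injective ι ∧ (∀ c, Commute x (ι c)) ∧ (∀ c, Commute y (ι c)) ∧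
      x * ⁅x, y⁆ = ι ε₁ * (⁅x, y⁆ * x) ∧ y * ⁅x, y⁆ = ι ε₂ * (⁅x, y⁆ * y) ∧
      ⁅x, y⁆ ^ 2 = ι (ζ ^ 2) := by
  have hf : ∃ f : ℤ → Q, ∀ m, f m = ε₁ ^ (m + 1) * f (m + 1) := by
    refine ⟨fun m => ε₁ ^ (m * (m + 1) / 2), fun m => ?_⟩
    dsimp only
    rw [← zpow_add, show (m + 1) * (m + 1 + 1) = m * (m + 1) + (m + 1) * 2 by ring,
      Int.add_mul_ediv_right _ _ two_ne_zero,
      show m + 1 + (m * (m + 1) / 2 + (m + 1)) = m * (m + 1) / 2 + 2 * (m + 1) by ring,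
      zpow_add, zpow_mul ε₁ 2]
    norm_cast
    simp [h₁]
  obtain ⟨f, hf⟩ := hf
  let w : ℤ → ℤ → Q := fun m n => f m * ε₂ ^ (m * (n + 1)) * ζ ^ (-m)
  let q : ℤ → ℤ → Q := fun m n => ζ * ε₁ ^ m * ε₂ ^ n
  have hw (m n : ℤ) : w m n = q (m + 1) (n + 1) * w (m + 1) n := by
    simp only [w, q]
    rw [hf m]
    have : ε₂ ^ ((m + 1) * (n + 1)) = ε₂ ^ (m * (n + 1)) * ε₂ ^ (n + 1) := by
      rw [← zpow_add]; congr 1; ring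
    have e2 : ε₂ ^ (n + 1) * ε₂ ^ (n + 1) = 1 := by
      rw [← mul_zpow, ← pow_two, h₂, one_zpow]
    rw [this, neg_add, zpow_add ζ, zpow_neg_one]
    calc _ = ε₁ ^ (m + 1) * f (m + 1) * ε₂ ^ (m * (n + 1)) * ζ ^ (-m) * 1 * (ζ * ζ⁻¹) := by simp
      _ = _ := by rw [← e2]; ac_rfl
  let x : Equiv.Perm (ℤ × ℤ × Q) :=
    { toFun := fun t => (t.1 + 1, t.2.1, t.2.2)
      invFun := fun t => (t.1 - 1, t.2.1, t.2.2)
      left_inv := fun t => by simp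
      right_inv := fun t => by simp }
  let y : Equiv.Perm (ℤ × ℤ × Q) :=
    { toFun := fun t => (t.1, t.2.1 + 1, w t.1 t.2.1 * t.2.2)
      invFun := fun t => (t.1, t.2.1 - 1, (w t.1 (t.2.1 - 1))⁻¹ * t.2.2)
      left_inv := fun t => by simp
      right_inv := fun t => by simp }
  let ι : Q →* Equiv.Perm (ℤ × ℤ × Q) :=
    { toFun := fun c =>
        { toFun := fun t => (t.1, t.2.1, c * t.2.2)
          invFun := fun t => (t.1, t.2.1, c⁻¹ * t.2.2)
          left_inv := fun t => by simp
          right_inv := fun t => by simp }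
      map_one' := by ext t <;> simp
      map_mul' := fun c d => by ext t <;> simp [mul_assoc] }
  let K : Equiv.Perm (ℤ × ℤ × Q) :=
    { toFun := fun t => (t.1, t.2.1, q t.1 t.2.1 * t.2.2)
      invFun := fun t => (t.1, t.2.1, (q t.1 t.2.1)⁻¹ * t.2.2)
      left_inv := fun t => by simp
      right_inv := fun t => by simp }
  have hx (t) : x t = (t.1 + 1, t.2.1, t.2.2) := rfl
  have hy (t) : y t = (t.1, t.2.1 + 1, w t.1 t.2.1 * t.2.2) := rfl
  have hι (c t) : ι c t = (t.1, t.2.1, c * t.2.2) := rfl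
  have hKt (t) : K t = (t.1, t.2.1, q t.1 t.2.1 * t.2.2) := rfl
  have hK : ⁅x, y⁆ = K := by
    rw [commutatorElement_def, mul_inv_eq_iff_eq_mul, mul_inv_eq_iff_eq_mul]
    refine Equiv.ext fun t => ?_
    simp only [Equiv.Perm.mul_apply, hx, hy, hKt]
    rw [hw, mul_assoc]
  have e1 (m : ℤ) : ε₁ ^ m = ε₁ * ε₁ ^ (m + 1) := by
    rw [zpow_add, zpow_one, mul_left_comm, ← pow_two, h₁, mul_one]
  have e2 (m : ℤ) : ε₂ ^ m = ε₂ * ε₂ ^ (m + 1) := by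
    rw [zpow_add, zpow_one, mul_left_comm, ← pow_two, h₂, mul_one]
  refine ⟨x, y, ι, fun c d h => ?_, fun c => ?_, fun c => ?_, ?_, ?_, ?_⟩
  · have := congrArg (fun g => (g (0, 0, 1)).2.2) h
    simpa [hι] using this
  · exact Equiv.ext fun t => rfl
  · refine Equiv.ext fun t => ?_
    simp only [Equiv.Perm.mul_apply, hι, hy, mul_left_comm]
  · rw [hK]
    refine Equiv.ext fun t => ?_
    simp only [Equiv.Perm.mul_apply, hι, hx, hKt, q]
    rw [e1 t.1]
    simp only [mul_assoc, mul_left_comm]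
  · rw [hK]
    refine Equiv.ext fun t => ?_
    simp only [Equiv.Perm.mul_apply, hι, hy, hKt, q]
    rw [e2 t.2.1]
    simp only [mul_assoc, mul_left_comm]
  · rw [hK, pow_two]
    refine Equiv.ext fun t => ?_
    simp only [Equiv.Perm.mul_apply, hι, hKt, q]
    have e1 : ε₁ ^ t.1 * ε₁ ^ t.1 = 1 := by rw [← mul_zpow, ← pow_two, h₁, one_zpow]
    have e2 : ε₂ ^ t.2.1 * ε₂ ^ t.2.1 = 1 := by rw [← mul_zpow, ← pow_two, h₂, one_zpow]
    rw [← mul_assoc, show ζ * ε₁ ^ t.1 * ε₂ ^ t.2.1 * (ζ * ε₁ ^ t.1 * ε₂ ^ t.2.1) =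
      ζ ^ 2 * (ε₁ ^ t.1 * ε₁ ^ t.1) * (ε₂ ^ t.2.1 * ε₂ ^ t.2.1) by
        rw [pow_two]; simp only [mul_assoc, mul_left_comm], e1, e2, mul_one, mul_one]

/-- A divisible commutative group is a retract of the centre of any group in which it embeds
centrally. -/
theorem exists_retraction_center {E Q : Type*} [Group E] [CommGroup Q]
    (hQ : Module.Baer ℤ (Additive Q)) (ι : Q →* E) (hinj : Function.Injective ι)
    (hι : ∀ c, ι c ∈ Subgroup.center E) :
    ∃ ψ : Subgroup.center E →* Q, ∀ c, ψ ⟨ι c, hι c⟩ = c := by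
  let f : Q →* Subgroup.center E := ι.codRestrict _ hι
  have hf : Function.Injective f := fun x y hxy => hinj (congrArg Subtype.val hxy)
  obtain ⟨h, hh⟩ := hQ.extension_property_addMonoidHom (M := Additive Q)
    (N := Additive (Subgroup.center E)) (MonoidHom.toAdditive f) hf (AddMonoidHom.id _)
  exact ⟨MonoidHom.toAdditive.symm h, fun c => DFunLike.congr_fun hh c⟩

theorem sq_mul_of_mul_commutator {E : Type*} [Group E] {a b e : E}
    (h : a * ⁅a, b⁆ = e * (⁅a, b⁆ * a)) : a ^ 2 * b = e * ⁅a, b⁆ ^ 2 * (b * a ^ 2) := by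
  have hab : a * b = ⁅a, b⁆ * (b * a) := by simp [commutatorElement_def]
  calc a ^ 2 * b = a * ⁅a, b⁆ * (b * a) := by rw [pow_two, mul_assoc, hab, mul_assoc]
    _ = e * ⁅a, b⁆ * (a * b) * a := by rw [h]; simp only [mul_assoc]
    _ = e * ⁅a, b⁆ ^ 2 * (b * a ^ 2) := by
      rw [hab, pow_two, pow_two]; simp only [mul_assoc]

theorem mul_sq_of_mul_commutator {E : Type*} [Group E] {a b e : E}
    (h : b * ⁅a, b⁆ = e * (⁅a, b⁆ * b)) (he : ⁅a, b⁆ * e = e * ⁅a, b⁆) :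
    a * b ^ 2 = e * ⁅a, b⁆ ^ 2 * (b ^ 2 * a) := by
  have hab : a * b = ⁅a, b⁆ * (b * a) := by simp [commutatorElement_def]
  calc a * b ^ 2 = ⁅a, b⁆ * b * (a * b) := by
        rw [pow_two, ← mul_assoc]; conv_lhs => rw [hab]
        simp only [mul_assoc]
    _ = ⁅a, b⁆ * (b * ⁅a, b⁆) * (b * a) := by rw [hab]; simp only [mul_assoc]
    _ = ⁅a, b⁆ * e * (⁅a, b⁆ * b) * (b * a) := by rw [h]; simp only [mul_assoc]
    _ = e * ⁅a, b⁆ ^ 2 * (b ^ 2 * a) := by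
      rw [he, pow_two, pow_two]; simp only [mul_assoc]

open Subgroup in
/-- A central extension of `G` with prescribed scalar commutators yields a 2-cocycle pairing the
commutator of the two generators with each of them by the given scalars. -/
theorem exists_cocycle_of_commutator_relations {E G Q : Type*} [Group E] [Group G] [CommGroup Q]
    (hQ : Module.Baer ℤ (Additive Q)) (p : E →* G) (hp : Function.Surjective p)
    (ι : Q →* E) (hinj : Function.Injective ι) (hι : ∀ (c : Q) (e : E), e * ι c = ι c * e)
    (hpι : ∀ c, p (ι c) = 1) (a b : E) (hgen : closure ({a, b} ∪ Set.range ι) = ⊤)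
    (χ₁ : centralizer {p a} →* Q) (χ₂ : centralizer {p b} →* Q)
    (hab : ¬ Commute (p a) (p b))
    (ε₁ ε₂ z : Q) (hε₁ : ε₁ ^ 2 = 1) (hε₂ : ε₂ ^ 2 = 1)
    (haK : a * ⁅a, b⁆ = ι ε₁ * (⁅a, b⁆ * a)) (hbK : b * ⁅a, b⁆ = ι ε₂ * (⁅a, b⁆ * b))
    (hK : ⁅a, b⁆ ^ 2 = ι z)
    (ha₁ : p a ^ 2 ∈ centralizer {p a}) (ha₂ : p a ^ 2 ∈ centralizer {p b})
    (hb₁ : p b ^ 2 ∈ centralizer {p a}) (hb₂ : p b ^ 2 ∈ centralizer {p b})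
    (hK₁ : p ⁅a, b⁆ ∈ centralizer {p a}) (hK₂ : p ⁅a, b⁆ ∈ centralizer {p b})
    (hχa₁ : χ₁ ⟨_, ha₁⟩ = 1) (hχb₂ : χ₂ ⟨_, hb₂⟩ = 1)
    (hχK₁ : χ₁ ⟨_, hK₁⟩ = ε₁) (hχK₂ : χ₂ ⟨_, hK₂⟩ = ε₂)
    (hχa₂ : χ₂ ⟨_, ha₂⟩ = ε₁ * z) (hχb₁ : χ₁ ⟨_, hb₁⟩ = ε₂ * z⁻¹) :
    ∃ σ : G → G → Q,
      (∀ x y w : G, σ x y * σ (x * y) w = σ x (y * w) * σ y w) ∧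
      σ (p a) (p ⁅a, b⁆) = ε₁ * σ (p ⁅a, b⁆) (p a) ∧
      σ (p b) (p ⁅a, b⁆) = ε₂ * σ (p ⁅a, b⁆) (p b) := by
  have hflip {ε : Q} (hε : ε ^ 2 = 1) {x y : E} (h : x * y = ι ε * (y * x)) :
      y * x = ι ε * (x * y) := by
    rw [h, ← mul_assoc, ← map_mul, ← pow_two, hε, map_one, one_mul]
  have hker : p.ker ≤ center E := by
    refine ker_le_center_of_twistedCentralizer p ι hι hpι a b hgen χ₁ χ₂ hab
      ⟨mem_twistedCentralizer_of_eq ha₁ (map_pow p a 2) ?_,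
        mem_twistedCentralizer_of_eq ha₂ (map_pow p a 2) ?_⟩
      ⟨mem_twistedCentralizer_of_eq hb₁ (map_pow p b 2) ?_,
        mem_twistedCentralizer_of_eq hb₂ (map_pow p b 2) ?_⟩
      ⟨mem_twistedCentralizer_of_eq hK₁ rfl ?_, mem_twistedCentralizer_of_eq hK₂ rfl ?_⟩
    · rw [hχa₁, map_one, one_mul, pow_mul_comm']
    · rw [hχa₂, map_mul, ← hK]
      exact sq_mul_of_mul_commutator haK
    · rw [hχb₁, mul_sq_of_mul_commutator hbK (hι _ _), hK, ← mul_assoc, ← map_mul, ← map_mul]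
      rw [show ε₂ * z⁻¹ * (ε₂ * z) = 1 by
        rw [mul_mul_mul_comm, ← pow_two, hε₂, inv_mul_cancel, one_mul], map_one, one_mul]
    · rw [hχb₂, map_one, one_mul, pow_mul_comm']
    · rw [hχK₁]
      exact hflip hε₁ haK
    · rw [hχK₂]
      exact hflip hε₂ hbK
  have hιc (c : Q) : ι c ∈ center E := mem_center_iff.mpr (hι c)
  obtain ⟨ψ, hψ⟩ := exists_retraction_center hQ ι hinj hιc
  obtain ⟨σ, hσ, hσ'⟩ := exists_cocycle_of_central_extension p hp hker ψ
  refine ⟨σ, hσ, ?_, ?_⟩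
  · rw [hσ' a ⁅a, b⁆ ⟨ι ε₁, hιc _⟩ (hpι _) haK, hψ]
  · rw [hσ' b ⁅a, b⁆ ⟨ι ε₂, hιc _⟩ (hpι _) hbK, hψ]

theorem baer_additive_units (k : Type*) [Field k] [IsAlgClosed k] [CharZero k] :
    Module.Baer ℤ (Additive kˣ) := by
  have hroot (n : ℕ) (hn : n ≠ 0) (u : kˣ) : ∃ v : kˣ, v ^ n = u := by
    obtain ⟨v, hv⟩ := IsAlgClosed.exists_pow_nat_eq (u : k) (Nat.pos_of_ne_zero hn)
    have hv0 : v ≠ 0 := by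
      rintro rfl
      rw [zero_pow hn] at hv
      exact u.ne_zero hv.symm
    exact ⟨Units.mk0 v hv0, Units.ext hv⟩
  have : RootableBy kˣ ℕ := rootableByOfPowLeftSurj _ _ fun {n} hn u => hroot n hn u
  have : RootableBy kˣ ℤ := Group.rootableByIntOfRootableByNat kˣ
  have : DivisibleBy (Additive kˣ) ℤ := divisibleByOfSMulRightSurj _ _ fun {n} hn u =>
    ⟨Additive.ofMul (RootableBy.root u.toMul n), RootableBy.root_cancel u.toMul hn⟩
  exact Module.Baer.of_divisible _


/-- Type `α₂`: there is a 2-cocycle `σ` on `G` trivializing the action of `κ`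
on the twisted characters. -/
theorem stmt_6 {k : Type*} [Field k] [IsAlgClosed k] [CharZero k]
    {G : Type*} [Group G] (κ g₁ g₂ : G)
    (hκc : ∀ x : G, κ * x = x * κ) (hκ1 : κ ≠ 1) (hκ2 : κ ^ 2 = 1)
    (hc₁ : ∀ x : G, x * g₁ * x⁻¹ = g₁ ∨ x * g₁ * x⁻¹ = κ * g₁)
    (hc₁' : ∃ x : G, x * g₁ * x⁻¹ = κ * g₁)
    (hc₂ : ∀ x : G, x * g₂ * x⁻¹ = g₂ ∨ x * g₂ * x⁻¹ = κ * g₂)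
    (hc₂' : ∃ x : G, x * g₂ * x⁻¹ = κ * g₂)
    (hcomm : g₁ * g₂ = κ * (g₂ * g₁))
    (hgen : Subgroup.closure {g₁, g₂} = ⊤)
    (χ₁ : ↥(Subgroup.centralizer {g₁}) →* kˣ)
    (χ₂ : ↥(Subgroup.centralizer {g₂}) →* kˣ)
    (hχ₁ : ∀ hm : g₁ ∈ Subgroup.centralizer {g₁}, χ₁ ⟨g₁, hm⟩ = -1)
    (hχ₂ : ∀ hm : g₂ ∈ Subgroup.centralizer {g₂}, χ₂ ⟨g₂, hm⟩ = -1)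
    (hcompat : ∀ (h₁ : κ * g₂ ^ 2 ∈ Subgroup.centralizer {g₁})
        (h₂ : κ * g₁ ^ 2 ∈ Subgroup.centralizer {g₂}),
      χ₁ ⟨κ * g₂ ^ 2, h₁⟩ * χ₂ ⟨κ * g₁ ^ 2, h₂⟩ = 1) :
    ∃ σ : G → G → kˣ,
      (∀ a b c : G, σ a b * σ (a * b) c = σ a (b * c) * σ b c) ∧
      (∀ hm : κ ∈ Subgroup.centralizer {g₁},
        σ g₁ κ * (σ κ g₁)⁻¹ * χ₁ ⟨κ, hm⟩ = 1) ∧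
      (∀ hm : κ ∈ Subgroup.centralizer {g₂},
        σ g₂ κ * (σ κ g₂)⁻¹ * χ₂ ⟨κ, hm⟩ = 1) := by
  have hK₁ : κ ∈ Subgroup.centralizer {g₁} := Subgroup.mem_centralizer_singleton_iff.mpr (hκc g₁)
  have hK₂ : κ ∈ Subgroup.centralizer {g₂} := Subgroup.mem_centralizer_singleton_iff.mpr (hκc g₂)
  have hκκ : κ * κ = 1 := by rw [← pow_two, hκ2]
  have hκg : ⁅g₁, g₂⁆ = κ := by
    rw [commutatorElement_def, mul_inv_eq_iff_eq_mul, mul_inv_eq_iff_eq_mul, hcomm, mul_assoc]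
  have hself (g : G) : g ∈ Subgroup.centralizer {g} :=
    Subgroup.mem_centralizer_singleton_iff.mpr rfl
  have ha₂ : g₁ ^ 2 ∈ Subgroup.centralizer {g₂} := by
    rw [Subgroup.mem_centralizer_singleton_iff,
      sq_mul_of_mul_commutator (e := 1) (by rw [hκg, one_mul, hκc]), hκg, hκ2, one_mul, one_mul]
  have hb₁ : g₂ ^ 2 ∈ Subgroup.centralizer {g₁} := by
    rw [Subgroup.mem_centralizer_singleton_iff,
      mul_sq_of_mul_commutator (e := 1) (by rw [hκg, one_mul, hκc]) (by simp), hκg, hκ2, one_mul,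
      one_mul]
  obtain ⟨ε₁, hε₁⟩ : ∃ ε, χ₁ ⟨κ, hK₁⟩ = ε := ⟨_, rfl⟩
  obtain ⟨ε₂, hε₂⟩ : ∃ ε, χ₂ ⟨κ, hK₂⟩ = ε := ⟨_, rfl⟩
  have hε₁2 : ε₁ ^ 2 = 1 := by
    rw [← hε₁, ← map_pow, show (⟨κ, hK₁⟩ : Subgroup.centralizer {g₁}) ^ 2 = 1 from
      Subtype.ext hκ2, map_one]
  have hε₂2 : ε₂ ^ 2 = 1 := by
    rw [← hε₂, ← map_pow, show (⟨κ, hK₂⟩ : Subgroup.centralizer {g₂}) ^ 2 = 1 from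
      Subtype.ext hκ2, map_one]
  obtain ⟨α, hα⟩ : ∃ α, χ₂ ⟨g₁ ^ 2, ha₂⟩ = α := ⟨_, rfl⟩
  obtain ⟨β, hβ⟩ : ∃ β, χ₁ ⟨g₂ ^ 2, hb₁⟩ = β := ⟨_, rfl⟩
  have hαβ : ε₁ * β * (ε₂ * α) = 1 := by
    rw [← hε₁, ← hε₂, ← hα, ← hβ, ← map_mul, ← map_mul]
    exact hcompat (mul_mem hK₁ hb₁) (mul_mem hK₂ ha₂)
  obtain ⟨ζ, hζ⟩ : ∃ ζ : kˣ, ζ ^ 2 = ε₁ * α := by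
    obtain ⟨v, hv⟩ := IsAlgClosed.exists_pow_nat_eq ((ε₁ * α : kˣ) : k) two_pos
    have hv0 : v ≠ 0 := by
      rintro rfl
      rw [zero_pow two_ne_zero] at hv
      exact (ε₁ * α).ne_zero hv.symm
    exact ⟨Units.mk0 v hv0, Units.ext hv⟩
  obtain ⟨x, y, ι, hinj, hxι, hyι, hxK, hyK, hKK⟩ :=
    exists_perm_commutator_relations ζ ε₁ ε₂ hε₁2 hε₂2
  let ι' : kˣ →* Equiv.Perm (ℤ × ℤ × kˣ) × G := ι.prod 1
  let s : Set (Equiv.Perm (ℤ × ℤ × kˣ) × G) := {(x, g₁), (y, g₂)} ∪ Set.range ι'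
  let E : Subgroup (Equiv.Perm (ℤ × ℤ × kˣ) × G) := Subgroup.closure s
  let a : E := ⟨(x, g₁), Subgroup.subset_closure (by simp [s])⟩
  let b : E := ⟨(y, g₂), Subgroup.subset_closure (by simp [s])⟩
  let j : kˣ →* E := ι'.codRestrict E fun c => Subgroup.subset_closure (by simp [s])
  let p : E →* G := (MonoidHom.snd _ _).comp E.subtype
  have hp : Function.Surjective p := by
    rw [← MonoidHom.range_eq_top, eq_top_iff, ← hgen, Subgroup.closure_le]
    rintro _ (rfl | rfl)
    · exact ⟨a, rfl⟩
    · exact ⟨b, rfl⟩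
  have hιc (c d : kˣ) : ι c * ι d = ι d * ι c := by rw [← map_mul, mul_comm, map_mul]
  have hj (c : kˣ) (e : E) : e * j c = j c * e := by
    have : E ≤ Subgroup.centralizer {ι' c} := by
      rw [Subgroup.closure_le]
      rintro _ ((rfl | rfl) | ⟨d, rfl⟩) <;>
        refine Subgroup.mem_centralizer_singleton_iff.mpr (Prod.ext ?_ ?_)
      · exact hxι c
      · simp [ι']
      · exact hyι c
      · simp [ι']
      · exact hιc d c
      · simp [ι']
    exact Subtype.ext (Subgroup.mem_centralizer_singleton_iff.mp (this e.2))
  have hgenE : Subgroup.closure ({a, b} ∪ Set.range j) = ⊤ := by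
    rw [← Subgroup.closure_closure_coe_preimage (k := s)]
    congr 1
    ext e
    simp [s, a, b, j, Subtype.ext_iff]
  have hKval : ⁅a, b⁆ = (⁅x, y⁆, κ) := by
    rw [← hκg]; rfl
  have hpK : p ⁅a, b⁆ = κ := hκg
  have hsq {g : G} {χ : Subgroup.centralizer {g} →* kˣ}
      (h : ∀ hm : g ∈ Subgroup.centralizer {g}, χ ⟨g, hm⟩ = -1) :
      χ ⟨g ^ 2, pow_mem (hself g) 2⟩ = 1 := by
    have : (⟨g ^ 2, pow_mem (hself g) 2⟩ : Subgroup.centralizer {g}) = ⟨g, hself g⟩ ^ 2 := rfl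
    rw [this, map_pow, h, neg_one_sq]
  obtain ⟨σ, hσ, h₁, h₂⟩ := exists_cocycle_of_commutator_relations (baer_additive_units k) p hp j
    (fun c d h => hinj (congrArg (fun e : E => e.1.1) h)) hj (fun c => rfl) a b hgenE χ₁ χ₂
    (fun h => hκ1 (by rw [← hκg]; exact commutatorElement_eq_one_iff_commute.mpr h))
    ε₁ ε₂ (ζ ^ 2) hε₁2 hε₂2
    (Subtype.ext (Prod.ext hxK (by simp [a, j, ι', hKval, hκc])))
    (Subtype.ext (Prod.ext hyK (by simp [b, j, ι', hKval, hκc])))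
    (Subtype.ext (Prod.ext hKK (by simp [j, ι', hKval, hκ2])))
    (pow_mem (hself g₁) 2) ha₂ hb₁ (pow_mem (hself g₂) 2) (hpK ▸ hK₁) (hpK ▸ hK₂)
    (hsq hχ₁) (hsq hχ₂)
    (by rw [← hε₁]; congr 1; exact Subtype.ext hpK)
    (by rw [← hε₂]; congr 1; exact Subtype.ext hpK)
    (hα.trans (by rw [hζ, ← mul_assoc, ← pow_two, hε₁2, one_mul]))
    (hβ.trans (by
      rw [hζ, eq_mul_inv_iff_mul_eq, ← mul_one ε₂, ← hαβ]
      calc β * (ε₁ * α) = ε₁ * β * α * ε₂ ^ 2 := by rw [hε₂2, mul_one]; ac_rfl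
        _ = _ := by rw [pow_two]; ac_rfl))
  rw [hpK] at h₁ h₂
  refine ⟨σ, hσ, fun _ => ?_, fun _ => ?_⟩
  · rw [hε₁, show σ g₁ κ = _ from h₁]
    change ε₁ * σ κ g₁ * (σ κ g₁)⁻¹ * ε₁ = 1
    rw [mul_inv_cancel_right, ← pow_two, hε₁2]
  · rw [hε₂, show σ g₂ κ = _ from h₂]
    change ε₂ * σ κ g₂ * (σ κ g₂)⁻¹ * ε₂ = 1
    rw [mul_inv_cancel_right, ← pow_two, hε₂2]
end

section
/- Let G be a group, κ ∈ G central with κ ≠ 1 and κ² = 1, and g₁, g₂, g₃ ∈ G, each with conjugacy class {g_i, κ·g_i}, such that g₁·g₂ = κ·g₂·g₁, g₂·g₃ = κ·g₃·g₂, g₁·g₃ = g₃·g₁, and G is generated by g₁, g₂, g₃. Let χ_i : C_G(g_i) → kˣ be group homomorphisms with χ_i(g_i) = −1 for i = 1, 2, 3, satisfying χ₁(κ·g₂²)·χ₂(κ·g₁²) = 1, χ₂(κ·g₃²)·χ₃(κ·g₂²) = 1, χ₁(g₃)·χ₃(g₁) = 1 and χ₁(κ)·χ₃(κ) = 1 (the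 conditions defining a Yetter–Drinfeld module of type α₃ whose support generates G). Then there exists a 2-cocycle σ on G with values in kˣ such that σ(g_i, κ)·σ(κ, g_i)⁻¹·χ_i(κ) = 1 for i = 1, 2, 3. -/
/-- The unit group of an algebraically closed field is an injective abelian group. -/
theorem exists_monoidHom_extension {k : Type*} [Field k] [IsAlgClosed k] {M N : Type*}
    [CommGroup M] [CommGroup N] (f : M →* N) (hf : Function.Injective f) (g : M →* kˣ) :
    ∃ h : N →* kˣ, h.comp f = g := by
  let : RootableBy kˣ ℕ := rootableByOfPowLeftSurj _ _ fun {n} hn a => by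
    obtain ⟨z, hz⟩ := IsAlgClosed.exists_pow_nat_eq (a : k) (Nat.pos_of_ne_zero hn)
    have hz0 : z ≠ 0 := by
      rintro rfl
      rw [zero_pow hn] at hz
      exact a.ne_zero hz.symm
    exact ⟨Units.mk0 z hz0, Units.ext (by simpa using hz)⟩
  let : RootableBy kˣ ℤ := Group.rootableByIntOfRootableByNat kˣ
  let : DivisibleBy (Additive kˣ) ℤ :=
    { div := fun a n => Additive.ofMul (RootableBy.root a.toMul n)
      div_zero := fun a => congrArg Additive.ofMul (RootableBy.root_zero a.toMul)
      div_cancel := fun a hn => congrArg Additive.ofMul (RootableBy.root_cancel a.toMul hn) }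
  obtain ⟨h, hh⟩ := (Module.Baer.of_divisible (Additive kˣ)).extension_property_addMonoidHom
    (MonoidHom.toAdditive f) hf (MonoidHom.toAdditive g)
  exact ⟨MonoidHom.toAdditive.symm h, MonoidHom.ext fun x => DFunLike.congr_fun hh x⟩

/-- `x` and `y` commute up to the scalar `a`, scalars being embedded through `c`. -/
def CommutesUpTo {A E : Type*} [CommGroup A] [Group E] (c : A →* E) (x y : E) (a : A) : Prop :=
  x * y = c a * (y * x)

/-- A central extension of `G` with central kernel containing `kˣ` yields a 2-cocycle on `G`
whose antisymmetrization is read off from the commutators in the extension. -/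
theorem exists_cocycle_of_central_extension_s7 {k : Type*} [Field k] [IsAlgClosed k]
    {E G : Type*} [Group E] [Group G] (π : E →* G) (hπ : Function.Surjective π)
    (hker : π.ker ≤ Subgroup.center E) (c : kˣ →* E) (hc : Function.Injective c)
    (hπc : ∀ a, π (c a) = 1) :
    ∃ σ : G → G → kˣ,
      (∀ x y z : G, σ x y * σ (x * y) z = σ x (y * z) * σ y z) ∧
      ∀ (X Y : E) (a : kˣ), CommutesUpTo c X Y a →
        σ (π X) (π Y) = a * σ (π Y) (π X) := by
  let : CommGroup (Subgroup.center E) :=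
    { Subgroup.toGroup (Subgroup.center E) with
      mul_comm := fun x y => Subtype.ext (Subgroup.mem_center_iff.1 y.2 x) }
  let c' : kˣ →* Subgroup.center E := c.codRestrict _ fun a => hker (hπc a)
  have hc' : Function.Injective c' := fun a b h => hc (congrArg Subtype.val h)
  obtain ⟨f, hf⟩ := exists_monoidHom_extension c' hc' (MonoidHom.id kˣ)
  choose T hT using hπ
  have hn : ∀ x y, ∃ n : Subgroup.center E, (n : E) * T (x * y) = T x * T y := fun x y =>
    ⟨⟨T x * T y * (T (x * y))⁻¹, hker (by simp [MonoidHom.mem_ker, hT])⟩, by simp⟩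
  choose n hn using hn
  have central : ∀ (m : Subgroup.center E) (x : E), x * m = m * x := fun m x =>
    Subgroup.mem_center_iff.1 m.2 x
  refine ⟨fun x y => f (n x y), fun x y z => ?_, fun X Y a h => ?_⟩
  · rw [← map_mul, ← map_mul]
    congr 1
    apply Subtype.ext
    apply mul_right_cancel (b := T (x * y * z))
    push_cast
    calc (n x y : E) * n (x * y) z * T (x * y * z) = n x y * (n (x * y) z * T (x * y * z)) := by
          group
      _ = n x y * T (x * y) * T z := by rw [hn]; group
      _ = T x * (T y * T z) := by rw [hn]; group
      _ = T x * n y z * T (y * z) := by rw [← hn]; group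
      _ = n y z * (T x * T (y * z)) := by rw [central]; group
      _ = n y z * n x (y * z) * T (x * (y * z)) := by rw [← hn]; group
      _ = n x (y * z) * n y z * T (x * y * z) := by rw [central, mul_assoc x]
  · have key : n (π X) (π Y) = c' a * n (π Y) (π X) := by
      have lift : ∀ Z : E, ∃ m : Subgroup.center E, T (π Z) = m * Z := fun Z =>
        ⟨⟨T (π Z) * Z⁻¹, hker (by simp [MonoidHom.mem_ker, hT])⟩, by simp⟩
      obtain ⟨m, hm⟩ := lift X
      obtain ⟨m', hm'⟩ := lift Y
      have hXY : X * Y = c a * (Y * X) := h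
      have hcomm : π X * π Y = π Y * π X := by
        rw [← map_mul, hXY, map_mul, hπc, one_mul, map_mul]
      apply Subtype.ext
      apply mul_right_cancel (b := T (π X * π Y))
      have hca : ((c' a : Subgroup.center E) : E) = c a := rfl
      rw [hn, Subgroup.coe_mul, mul_assoc, hcomm, hn, hm, hm', hca]
      calc (m : E) * X * (m' * Y) = m * (X * m') * Y := by group
        _ = (m * m') * (X * Y) := by rw [central m' X]; group
        _ = (m * m') * (c a * (Y * X)) := by rw [hXY]
        _ = ((m * m' : Subgroup.center E) : E) * c' a * (Y * X) := by
          rw [hca, Subgroup.coe_mul]; group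
        _ = c a * (m * m' * (Y * X)) := by
          rw [← central (m * m'), hca, Subgroup.coe_mul]; group
        _ = c a * (m' * (m * Y) * X) := by rw [central m' m]; group
        _ = c a * (m' * Y * (m * X)) := by rw [← central m Y]; group
    have := congrArg f key
    rw [map_mul] at this
    change f _ = a * f _
    rw [this]
    congr 1
    exact DFunLike.congr_fun hf a

namespace CommutesUpTo

variable {A E : Type*} [CommGroup A] [Group E] {c : A →* E}

theorem symm {x y : E} {a : A} (h : CommutesUpTo c x y a) : CommutesUpTo c y x a⁻¹ := by
  unfold CommutesUpTo at *
  rw [h, map_inv, inv_mul_cancel_left]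

theorem mul_left (hc : ∀ (a : A) (x : E), c a * x = x * c a) {x x' y : E} {a b : A}
    (h : CommutesUpTo c x y a) (h' : CommutesUpTo c x' y b) :
    CommutesUpTo c (x * x') y (a * b) := by
  unfold CommutesUpTo at *
  rw [mul_assoc, h', ← mul_assoc x, ← hc, mul_assoc, ← mul_assoc x, h, mul_comm a, map_mul]
  group

theorem inv_left (hc : ∀ (a : A) (x : E), c a * x = x * c a) {x y : E} {a : A}
    (h : CommutesUpTo c x y a) : CommutesUpTo c x⁻¹ y a⁻¹ := by
  unfold CommutesUpTo at *
  rw [map_inv, eq_inv_mul_iff_mul_eq, ← mul_assoc, hc a x⁻¹, mul_assoc, inv_mul_eq_iff_eq_mul,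
    ← mul_assoc, h]
  group

theorem refl (x : E) : CommutesUpTo c x x 1 := by
  simp [CommutesUpTo]

theorem scalar (hc : ∀ (a : A) (x : E), c a * x = x * c a) (a : A) (x : E) :
    CommutesUpTo c (c a) x 1 := by
  simp [CommutesUpTo, hc a x]

end CommutesUpTo

/-- The elements over the centre of `G` commuting with each `Q i` up to the scalar given
by the character `α i`. -/
def scalarCommutant {A E G ι : Type*} [CommGroup A] [Group E] [Group G] (π : E →* G) (c : A →* E)
    (hc : ∀ (a : A) (x : E), c a * x = x * c a) (Q : ι → E)
    (α : ι → Subgroup.center G →* A) : Subgroup E where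
  carrier := {w | ∃ hw : π w ∈ Subgroup.center G, ∀ i, CommutesUpTo c w (Q i) (α i ⟨π w, hw⟩)}
  one_mem' := ⟨by simp, fun i => by
    have : (⟨π 1, by simp⟩ : Subgroup.center G) = 1 := Subtype.ext (map_one π)
    rw [this, map_one]
    simp [CommutesUpTo]⟩
  mul_mem' := by
    rintro x y ⟨hx, hx'⟩ ⟨hy, hy'⟩
    have hxy : π (x * y) ∈ Subgroup.center G := by rw [map_mul]; exact mul_mem hx hy
    refine ⟨hxy, fun i => ?_⟩
    have : (⟨π (x * y), hxy⟩ : Subgroup.center G) = ⟨π x, hx⟩ * ⟨π y, hy⟩ :=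
      Subtype.ext (map_mul π x y)
    rw [this, map_mul]
    exact (hx' i).mul_left hc (hy' i)
  inv_mem' := by
    rintro x ⟨hx, hx'⟩
    have hxi : π x⁻¹ ∈ Subgroup.center G := by rw [map_inv]; exact inv_mem hx
    refine ⟨hxi, fun i => ?_⟩
    have : (⟨π x⁻¹, hxi⟩ : Subgroup.center G) = ⟨π x, hx⟩⁻¹ := Subtype.ext (map_inv π x)
    rw [this, map_inv]
    exact (hx' i).inv_left hc

section ScalarCommutant

variable {A E G : Type*} [CommGroup A] [Group E] [Group G] {π : E →* G} {c : A →* E}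
  {hc : ∀ (a : A) (x : E), c a * x = x * c a}

theorem scalar_mem_scalarCommutant {ι : Type*} {Q : ι → E} {α : ι → Subgroup.center G →* A}
    (hπc : ∀ a, π (c a) = 1) (a : A) : c a ∈ scalarCommutant π c hc Q α := by
  refine ⟨by rw [hπc]; exact one_mem _, fun i => ?_⟩
  have : (⟨π (c a), by rw [hπc]; exact one_mem _⟩ : Subgroup.center G) = 1 := Subtype.ext (hπc a)
  rw [this, map_one]
  exact CommutesUpTo.scalar hc a (Q i)

theorem mul_scalarCommutant {ι : Type*} {Q : ι → E} {α : ι → Subgroup.center G →* A}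
    (hπc : ∀ a, π (c a) = 1) (i : ι) {w : E} (hw : w ∈ scalarCommutant π c hc Q α) :
    ∃ w' ∈ scalarCommutant π c hc Q α, Q i * w = w' * Q i := by
  obtain ⟨_, h⟩ := id hw
  exact ⟨c _ * w, mul_mem (scalar_mem_scalarCommutant hπc _) hw, by
    rw [mul_assoc]; exact (h i).symm⟩

variable {Q : Fin 3 → E} {α : Fin 3 → Subgroup.center G →* A} {K : E}

/-- Normal form of the elements of the subgroup generated by the `Q i` and the scalars. -/
theorem exists_eq_scalarCommutant_mul (hπc : ∀ a, π (c a) = 1)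
    (h01 : Q 0 * Q 1 = K * (Q 1 * Q 0))
    (hK : K ∈ scalarCommutant π c hc Q α)
    (h0 : Q 0 * Q 0 ∈ scalarCommutant π c hc Q α)
    (h1 : Q 1 * Q 1 ∈ scalarCommutant π c hc Q α)
    (h2 : Q 2 * (Q 0)⁻¹ ∈ scalarCommutant π c hc Q α)
    {X : E} (hX : X ∈ Subgroup.closure (Set.range Q ∪ Set.range c)) :
    ∃ w ∈ scalarCommutant π c hc Q α, ∃ a b : E,
      (a = 1 ∨ a = Q 0) ∧ (b = 1 ∨ b = Q 1) ∧ X = w * a * b := by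
  set M := scalarCommutant π c hc Q α with hM
  let p : E → Prop := fun X => ∃ w ∈ M, ∃ a b : E,
      (a = 1 ∨ a = Q 0) ∧ (b = 1 ∨ b = Q 1) ∧ X = w * a * b
  have hp : ∀ {v X}, v ∈ M → p X → p (v * X) := by
    rintro v X hv ⟨w, hw, a, b, ha, hb, rfl⟩
    exact ⟨v * w, mul_mem hv hw, a, b, ha, hb, by group⟩
  have hp0 : ∀ {X}, p X → p (Q 0 * X) := by
    rintro X ⟨w, hw, a, b, ha, hb, rfl⟩
    obtain ⟨w', hw', e⟩ := mul_scalarCommutant hπc 0 hw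
    have e' : Q 0 * (w * a * b) = w' * (Q 0 * a * b) := by
      rw [mul_assoc w, ← mul_assoc, e]; group
    rw [e']
    apply hp hw'
    rcases ha with rfl | rfl
    · exact ⟨1, one_mem _, Q 0, b, Or.inr rfl, hb, by group⟩
    · exact ⟨_, h0, 1, b, Or.inl rfl, hb, by group⟩
  have hp1 : ∀ {X}, p X → p (Q 1 * X) := by
    rintro X ⟨w, hw, a, b, ha, hb, rfl⟩
    obtain ⟨w', hw', e⟩ := mul_scalarCommutant hπc 1 hw
    have e' : Q 1 * (w * a * b) = w' * (Q 1 * a * b) := by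
      rw [mul_assoc w, ← mul_assoc, e]; group
    rw [e']
    apply hp hw'
    have hb' : p (Q 1 * b) := by
      rcases hb with rfl | rfl
      · exact ⟨1, one_mem _, 1, Q 1, Or.inl rfl, Or.inr rfl, by group⟩
      · exact ⟨_, h1, 1, 1, Or.inl rfl, Or.inl rfl, by group⟩
    rcases ha with rfl | rfl
    · simpa using hb'
    · have e'' : Q 1 * Q 0 * b = K⁻¹ * (Q 0 * (Q 1 * b)) := by
        rw [← mul_assoc (Q 0), h01]; group
      rw [e'']
      exact hp (inv_mem hK) (hp0 hb')
  have hp0' : ∀ {X}, p X → p ((Q 0)⁻¹ * X) := fun {X} h => by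
    have : (Q 0)⁻¹ * X = (Q 0 * Q 0)⁻¹ * (Q 0 * X) := by group
    rw [this]
    exact hp (inv_mem h0) (hp0 h)
  have hp1' : ∀ {X}, p X → p ((Q 1)⁻¹ * X) := fun {X} h => by
    have : (Q 1)⁻¹ * X = (Q 1 * Q 1)⁻¹ * (Q 1 * X) := by group
    rw [this]
    exact hp (inv_mem h1) (hp1 h)
  change p X
  induction hX using Subgroup.closure_induction_left with
  | one => exact ⟨1, one_mem _, 1, 1, Or.inl rfl, Or.inl rfl, by group⟩
  | mul_left x hx y _ ih =>
    rcases hx with ⟨i, rfl⟩ | ⟨a, rfl⟩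
    · fin_cases i
      · exact hp0 ih
      · exact hp1 ih
      · have : Q 2 * y = Q 2 * (Q 0)⁻¹ * (Q 0 * y) := by group
        change p (Q 2 * y)
        rw [this]
        exact hp h2 (hp0 ih)
    · exact hp (scalar_mem_scalarCommutant hπc a) ih
  | inv_mul_cancel x hx y _ ih =>
    rcases hx with ⟨i, rfl⟩ | ⟨a, rfl⟩
    · fin_cases i
      · exact hp0' ih
      · exact hp1' ih
      · have : (Q 2)⁻¹ * y = (Q 0)⁻¹ * ((Q 2 * (Q 0)⁻¹)⁻¹ * y) := by group
        change p ((Q 2)⁻¹ * y)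
        rw [this]
        exact hp0' (hp (inv_mem h2) ih)
    · exact hp (inv_mem (scalar_mem_scalarCommutant hπc a)) ih

theorem commute_of_map_eq_one (hπc : ∀ a, π (c a) = 1) (hκ1 : π K ≠ 1)
    (h01 : Q 0 * Q 1 = K * (Q 1 * Q 0))
    (hK : K ∈ scalarCommutant π c hc Q α)
    (h0 : Q 0 * Q 0 ∈ scalarCommutant π c hc Q α)
    (h1 : Q 1 * Q 1 ∈ scalarCommutant π c hc Q α)
    (h2 : Q 2 * (Q 0)⁻¹ ∈ scalarCommutant π c hc Q α)
    {X : E} (hX : X ∈ Subgroup.closure (Set.range Q ∪ Set.range c)) (hX1 : π X = 1) (i : Fin 3) :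
    Commute X (Q i) := by
  obtain ⟨w, hw, a, b, ha, hb, rfl⟩ := exists_eq_scalarCommutant_mul hπc h01 hK h0 h1 h2 hX
  have hz := fun x : G => Subgroup.mem_center_iff.1 hw.1 x
  have hne : π (Q 0) * π (Q 1) ≠ π (Q 1) * π (Q 0) := fun h => hκ1 (by
    have := congrArg π h01
    simpa [h] using this)
  have hab : π a * π b = (π w)⁻¹ := by
    rw [eq_inv_iff_mul_eq_one, hz, ← hX1]; simp [mul_assoc]
  have hab' : ∀ x, x * (π a * π b) = π a * π b * x := fun x => by
    rw [hab]; exact Subgroup.mem_center_iff.1 (inv_mem hw.1) x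
  rcases ha with rfl | rfl <;> rcases hb with rfl | rfl
  · obtain ⟨hw1, hw2⟩ := hw
    have : (⟨π w, hw1⟩ : Subgroup.center G) = 1 := Subtype.ext (by simpa using hX1)
    have h := hw2 i
    rw [this, map_one] at h
    simpa [CommutesUpTo, Commute, SemiconjBy] using h
  · exact (hne (by simpa using hab' (π (Q 0)))).elim
  · exact (hne (by simpa using (hab' (π (Q 1))).symm)).elim
  · refine (hne ?_).elim
    have := hab' (π (Q 0))
    rw [mul_assoc (π (Q 0)) (π (Q 1))] at this
    exact mul_left_cancel this

end ScalarCommutant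

/-- A cocycle on `G` from a lift of three generators of `G` to a group containing `kˣ`, such that
the lifts of suitable central elements of `G` commute with them up to given scalars. -/
theorem exists_cocycle_of_scalarCommutant {k : Type*} [Field k] [IsAlgClosed k]
    {E G : Type*} [Group E] [Group G] {π : E →* G} {c : kˣ →* E}
    {hc : ∀ (a : kˣ) (x : E), c a * x = x * c a} (hinj : Function.Injective c)
    (hπc : ∀ a, π (c a) = 1) {Q : Fin 3 → E} {α : Fin 3 → Subgroup.center G →* kˣ} {K : E}
    (hgen : Subgroup.closure (Set.range fun i => π (Q i)) = ⊤)
    (hκ1 : π K ≠ 1) (h01 : Q 0 * Q 1 = K * (Q 1 * Q 0))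
    (hK : K ∈ scalarCommutant π c hc Q α)
    (h0 : Q 0 * Q 0 ∈ scalarCommutant π c hc Q α)
    (h1 : Q 1 * Q 1 ∈ scalarCommutant π c hc Q α)
    (h2 : Q 2 * (Q 0)⁻¹ ∈ scalarCommutant π c hc Q α) :
    ∃ σ : G → G → kˣ,
      (∀ x y z : G, σ x y * σ (x * y) z = σ x (y * z) * σ y z) ∧
      ∀ i, σ (π (Q i)) (π K) * (σ (π K) (π (Q i)))⁻¹ * α i ⟨π K, hK.1⟩ = 1 := by
  let E₀ := Subgroup.closure (Set.range Q ∪ Set.range c)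
  have hQ : ∀ i, Q i ∈ E₀ := fun i => Subgroup.subset_closure (Or.inl ⟨i, rfl⟩)
  have hcE : ∀ a, c a ∈ E₀ := fun a => Subgroup.subset_closure (Or.inr ⟨a, rfl⟩)
  have hKE : K ∈ E₀ := by
    rw [← mul_inv_eq_iff_eq_mul.2 h01]
    exact mul_mem (mul_mem (hQ 0) (hQ 1)) (inv_mem (mul_mem (hQ 1) (hQ 0)))
  let π₀ : E₀ →* G := π.comp E₀.subtype
  let c₀ : kˣ →* E₀ := c.codRestrict E₀ hcE
  have hsurj : Function.Surjective π₀ := by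
    rw [← MonoidHom.range_eq_top, eq_top_iff, ← hgen, Subgroup.closure_le]
    rintro _ ⟨i, rfl⟩
    exact ⟨⟨Q i, hQ i⟩, rfl⟩
  have hker : π₀.ker ≤ Subgroup.center E₀ := by
    intro X hX
    have hle : E₀ ≤ Subgroup.centralizer {(X : E)} := by
      rw [Subgroup.closure_le]
      rintro _ (⟨i, rfl⟩ | ⟨a, rfl⟩)
      · exact Subgroup.mem_centralizer_singleton_iff.2
          (commute_of_map_eq_one hπc hκ1 h01 hK h0 h1 h2 X.2 hX i).symm
      · exact Subgroup.mem_centralizer_singleton_iff.2 (hc a X)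
    exact Subgroup.mem_center_iff.2 fun Y =>
      Subtype.ext (Subgroup.mem_centralizer_singleton_iff.1 (hle Y.2))
  obtain ⟨σ, hσ, hσ'⟩ := exists_cocycle_of_central_extension_s7 π₀ hsurj hker c₀
    (fun a b h => hinj (congrArg Subtype.val h)) hπc
  refine ⟨σ, hσ, fun i => ?_⟩
  have h : σ (π (Q i)) (π K) = (α i ⟨π K, hK.1⟩)⁻¹ * σ (π K) (π (Q i)) :=
    hσ' ⟨Q i, hQ i⟩ ⟨K, hKE⟩ _ (Subtype.ext (hK.2 i).symm)
  rw [h]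
  group

/-- The product of `H` with `ℤ³`, with multiplication twisted by the bimultiplicative map
`(v, w) ↦ p ^ (v₁ w₂) * q ^ (v₁ w₃) * r ^ (v₂ w₃)` embedded into `H` through `c`. -/
@[ext]
structure TwistedProduct {A H : Type*} [CommGroup A] [Group H] (c : A →* H) (p q r : A) where
  /-- The `H`-component. -/
  val : H
  /-- The first exponent. -/
  fst : ℤ
  /-- The second exponent. -/
  snd : ℤ
  /-- The third exponent. -/
  trd : ℤ

namespace TwistedProduct

variable {A H : Type*} [CommGroup A] [Group H] {c : A →* H} {p q r : A}

instance : Mul (TwistedProduct c p q r) where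
  mul v w := ⟨c (p ^ (v.fst * w.snd) * q ^ (v.fst * w.trd) * r ^ (v.snd * w.trd)) *
    (v.val * w.val), v.fst + w.fst, v.snd + w.snd, v.trd + w.trd⟩

instance : One (TwistedProduct c p q r) where
  one := ⟨1, 0, 0, 0⟩

instance : Inv (TwistedProduct c p q r) where
  inv v := ⟨c (p ^ (v.fst * v.snd) * q ^ (v.fst * v.trd) * r ^ (v.snd * v.trd)) * v.val⁻¹,
    -v.fst, -v.snd, -v.trd⟩

theorem mul_def (v w : TwistedProduct c p q r) : v * w =
    ⟨c (p ^ (v.fst * w.snd) * q ^ (v.fst * w.trd) * r ^ (v.snd * w.trd)) *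
      (v.val * w.val), v.fst + w.fst, v.snd + w.snd, v.trd + w.trd⟩ := rfl

theorem one_def : (1 : TwistedProduct c p q r) = ⟨1, 0, 0, 0⟩ := rfl

theorem inv_def (v : TwistedProduct c p q r) : v⁻¹ =
    ⟨c (p ^ (v.fst * v.snd) * q ^ (v.fst * v.trd) * r ^ (v.snd * v.trd)) * v.val⁻¹,
      -v.fst, -v.snd, -v.trd⟩ := rfl

theorem twisted_mul_assoc (hc : ∀ (a : A) (x : H), c a * x = x * c a) {a₁ a₂ a₃ a₄ : A}
    (h : a₁ * a₂ = a₃ * a₄) (u v w : H) :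
    c a₁ * (c a₂ * (u * v) * w) = c a₃ * (u * (c a₄ * (v * w))) := by
  rw [← mul_assoc u, ← hc, mul_assoc (c a₂), mul_assoc (c a₄), ← mul_assoc (c a₁),
    ← mul_assoc (c a₃), ← map_mul, ← map_mul, h, mul_assoc u]

/-- The group structure on a twisted product by central elements. -/
abbrev group (hc : ∀ (a : A) (x : H), c a * x = x * c a) : Group (TwistedProduct c p q r) :=
  Group.ofLeftAxioms
    (fun u v w => by
      simp only [mul_def]
      ext
      · apply twisted_mul_assoc hc
        simp only [add_mul, mul_add, zpow_add]
        ac_rfl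
      all_goals simp only [add_assoc])
    (fun v => by simp [mul_def, one_def])
    (fun v => by
      simp only [mul_def, one_def, inv_def]
      ext
      · simp only [neg_mul, zpow_neg, ← mul_inv, map_inv]
        group
      all_goals simp)

end TwistedProduct

theorem exists_matrix_relations {k : Type*} [Field k] [IsAlgClosed k] (a b : kˣ) (ha : a ^ 2 = 1)
    (hb : b ^ 2 = 1) (hab : ¬ (a = 1 ∧ b = 1)) :
    ∃ x y w : GL (Fin 2) k, x * y = w * (y * x) ∧
      w * w = Matrix.GeneralLinearGroup.scalar (Fin 2) (-1) ∧
      w * x = Matrix.GeneralLinearGroup.scalar (Fin 2) a * (x * w) ∧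
      w * y = Matrix.GeneralLinearGroup.scalar (Fin 2) b * (y * w) := by
  obtain ⟨i, hi⟩ := IsAlgClosed.exists_pow_nat_eq (-1 : k) two_pos
  have hi0 : i ≠ 0 := by
    rintro rfl
    norm_num at hi
  have hii : i * i = -1 := by rw [← hi, sq]
  have hsq : ∀ u : kˣ, u ^ 2 = 1 → u = 1 ∨ u = -1 := fun u hu => by
    have hu' : (u : k) * u = 1 := by rw [← Units.val_mul, ← sq, hu, Units.val_one]
    exact (mul_self_eq_one_iff.1 hu').imp (fun h => Units.ext h) (fun h => Units.ext h)
  let w : GL (Fin 2) k := Matrix.GeneralLinearGroup.mkOfDetNeZero !![i, 0; 0, -i] (by simp [hi0])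
  let s : GL (Fin 2) k := Matrix.GeneralLinearGroup.mkOfDetNeZero !![0, 1; 1, 0] (by simp)
  rcases hsq a ha with rfl | rfl <;> rcases hsq b hb with rfl | rfl
  · simp at hab
  · refine ⟨Matrix.GeneralLinearGroup.mkOfDetNeZero !![1, 0; 0, -i] (by simp [hi0]), s, w, ?_⟩
    refine ⟨?_, ?_, ?_, ?_⟩ <;> ext m n <;> fin_cases m <;> fin_cases n <;>
      simp [w, s, Matrix.GeneralLinearGroup.mkOfDetNeZero, hii, Matrix.mul_apply]
  · refine ⟨s, Matrix.GeneralLinearGroup.mkOfDetNeZero !![1, 0; 0, i] (by simp [hi0]), w, ?_⟩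
    refine ⟨?_, ?_, ?_, ?_⟩ <;> ext m n <;> fin_cases m <;> fin_cases n <;>
      simp [w, s, Matrix.GeneralLinearGroup.mkOfDetNeZero, hii, Matrix.mul_apply]
  · refine ⟨s, Matrix.GeneralLinearGroup.mkOfDetNeZero !![0, 1; i, 0] (by simp [hi0]), w, ?_⟩
    refine ⟨?_, ?_, ?_, ?_⟩ <;> ext m n <;> fin_cases m <;> fin_cases n <;>
      simp [w, s, Matrix.GeneralLinearGroup.mkOfDetNeZero, hii, Matrix.mul_apply]

/-- A group containing central scalars, with elements satisfying prescribed
commutation relations. -/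
theorem exists_group_relations.{u} {k : Type u} [Field k] [IsAlgClosed k] (a b s t u : kˣ)
    (ha : a ^ 2 = 1) (hb : b ^ 2 = 1) (hab : ¬ (a = 1 ∧ b = 1)) :
    ∃ (P : Type u) (_ : Group P) (c : kˣ →* P) (x y z w : P), Function.Injective c ∧
      (∀ (d : kˣ) (v : P), c d * v = v * c d) ∧ x * y = w * (y * x) ∧
      y * z = c s * (w * (z * y)) ∧ CommutesUpTo c x z t ∧ w * w = c u ∧
      CommutesUpTo c w x a ∧ CommutesUpTo c w y b ∧ CommutesUpTo c w z a := by
  obtain ⟨h, h', e, hx, he, hea, heb⟩ := exists_matrix_relations a b ha hb hab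
  obtain ⟨d, hd⟩ : ∃ d : kˣ, d * d = -u := by
    obtain ⟨d, hd⟩ := IsAlgClosed.exists_pow_nat_eq (-u : k) two_pos
    have hd0 : d ≠ 0 := by
      rintro rfl
      simp at hd
    exact ⟨Units.mk0 d hd0, Units.ext (by simpa [sq] using hd)⟩
  let ι := Matrix.GeneralLinearGroup.scalar (R := k) (Fin 2)
  have hι : ∀ (d : kˣ) (v : GL (Fin 2) k), ι d * v = v * ι d :=
    Matrix.GeneralLinearGroup.scalar_commute
  have hinj : Function.Injective ι := fun x y h => by
    have := congrArg (fun M : GL (Fin 2) k => M 0 0) h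
    exact Units.ext (by simpa [ι] using this)
  let : Group (TwistedProduct ι d t (-s * d)) := TwistedProduct.group hι
  have hmul : ∀ v w : TwistedProduct ι d t (-s * d), v * w = _ := TwistedProduct.mul_def
  let c : kˣ →* TwistedProduct ι d t (-s * d) :=
    { toFun := fun a => ⟨ι a, 0, 0, 0⟩
      map_one' := by simp [TwistedProduct.one_def]
      map_mul' := fun a b => by simp [hmul] }
  have hx' : h * h' = e * (h' * h) := hx
  have he' : e * e = ι (-1) := he
  have hea' : e * h = ι a * (h * e) := hea
  have heb' : e * h' = ι b * (h' * e) := heb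
  have hscal : ∀ (v : GL (Fin 2) k) (a : kˣ), e * v = ι a * (v * e) →
      ι d * e * v = ι a * (v * (ι d * e)) := fun v a h => by
    rw [mul_assoc, h, ← mul_assoc v, ← hι d v, ← mul_assoc, hι d, mul_assoc, mul_assoc]
  have hc : ∀ a, c a = ⟨ι a, 0, 0, 0⟩ := fun _ => rfl
  refine ⟨TwistedProduct ι d t (-s * d), inferInstance, c, ⟨h, 1, 0, 0⟩, ⟨h', 0, 1, 0⟩,
    ⟨h, 0, 0, 1⟩, ⟨ι d * e, 0, 0, 0⟩, fun a b hab => ?_,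
    fun a v => ?_, ?_, ?_, ?_, ?_, ?_, ?_, ?_⟩
  · exact hinj (congrArg TwistedProduct.val hab)
  · simp [hmul, hc, hι a]
  · simp [hmul, hx', mul_assoc]
  · simp only [hmul, hc]
    have key : ι (-(s * d)) * (h' * h) = ι s * (ι d * e * (h * h')) := by
      have hs : -(s * d) = s * d * -1 := by simp
      rw [hs, map_mul, map_mul, ← he', hx']
      simp only [mul_assoc]
    simpa using key
  · simp [CommutesUpTo, hmul, hc]
  · have key : ι d * e * (ι d * e) = ι u := by
      have hu : u = d * d * -1 := by simp [hd]
      rw [mul_assoc, ← mul_assoc e, ← hι, hu, map_mul, map_mul, ← he']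
      simp only [mul_assoc]
    simpa [hmul, hc] using key
  · simpa [CommutesUpTo, hmul, hc] using hscal h a hea'
  · simpa [CommutesUpTo, hmul, hc] using hscal h' b heb'
  · simpa [CommutesUpTo, hmul, hc] using hscal h a hea'

theorem CommutesUpTo.mul_self {A E : Type*} [CommGroup A] [Group E] {c : A →* E}
    (hc : ∀ (a : A) (x : E), c a * x = x * c a) {x y w : E} {e s u : A}
    (h : x * y = c s * (w * (y * x))) (hw : CommutesUpTo c w x e) (hu : w * w = c u) :
    CommutesUpTo c (x * x) y (s * s * e⁻¹ * u) := by
  have hw' : x * w = c e⁻¹ * (w * x) := hw.symm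
  unfold CommutesUpTo
  calc x * x * y = x * c s * (w * (y * x)) := by rw [mul_assoc, h]; group
    _ = c s * (x * w) * (y * x) := by rw [← hc]; group
    _ = c s * c e⁻¹ * w * (x * y) * x := by rw [hw']; group
    _ = c s * c e⁻¹ * (w * c s) * (w * (y * x)) * x := by rw [h]; group
    _ = c s * c e⁻¹ * c s * (w * w) * (y * (x * x)) := by rw [← hc s w]; group
    _ = c (s * s * e⁻¹ * u) * (y * (x * x)) := by
      rw [hu, ← map_mul, ← map_mul, ← map_mul, mul_right_comm s]

theorem CommutesUpTo.mul_inv_of_relations {A E : Type*} [CommGroup A] [Group E] {c : A →* E}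
    (hc : ∀ (a : A) (x : E), c a * x = x * c a) {x y z w : E} {e s u : A}
    (hxy : x * y = w * (y * x)) (hyz : y * z = c s * (w * (z * y)))
    (hu : w * w = c u) (hx : CommutesUpTo c w x e) (hz : CommutesUpTo c w z e) :
    CommutesUpTo c (z * x⁻¹) y (s * u)⁻¹ := by
  have hw : Commute w (z * x⁻¹) := by
    have h := ((hz.symm.mul_left hc (hx.symm.inv_left hc))).symm
    rw [inv_inv, inv_mul_cancel, inv_one, CommutesUpTo, map_one, one_mul] at h
    exact h
  have hyz' : c (s * u) * (z * y) = w * (y * z) := by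
    rw [hyz, ← mul_assoc w, ← hc, mul_assoc (c s), ← mul_assoc w, hu, map_mul, mul_assoc]
  unfold CommutesUpTo
  rw [map_inv, eq_inv_mul_iff_mul_eq]
  apply mul_left_cancel (a := w)
  apply mul_right_cancel (b := x)
  calc w * (c (s * u) * (z * x⁻¹ * y)) * x
      = c (s * u) * (w * (z * x⁻¹)) * y * x := by rw [← mul_assoc w, ← hc]; group
    _ = c (s * u) * (z * x⁻¹ * (w * (y * x))) := by rw [hw]; group
    _ = c (s * u) * (z * y) := by rw [← hxy]; group
    _ = w * (y * (z * x⁻¹)) * x := by rw [hyz']; group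

/-- A cocycle with prescribed commutators between `κ` and the generators `g i`, where the
compatibility conditions are expressed through characters of the centre. -/
theorem exists_cocycle_of_center_characters {k : Type*} [Field k] [IsAlgClosed k]
    {G : Type*} [Group G] (g : Fin 3 → G) (hgen : Subgroup.closure (Set.range g) = ⊤)
    (κ s₀ s₁ s₂ z : Subgroup.center G) (hκ1 : κ ≠ 1) (hκ2 : κ ^ 2 = 1)
    (h01 : g 0 * g 1 = κ * (g 1 * g 0)) (h12 : g 1 * g 2 = κ * (g 2 * g 1))
    (h02 : g 0 * g 2 = g 2 * g 0)
    (hs₀ : (s₀ : G) = g 0 ^ 2) (hs₁ : (s₁ : G) = g 1 ^ 2) (hs₂ : (s₂ : G) = g 2 ^ 2)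
    (hz : (z : G) = g 2 * (g 0)⁻¹)
    (α : Fin 3 → Subgroup.center G →* kˣ)
    (hα₀ : α 0 s₀ = 1) (hα₁ : α 1 s₁ = 1) (hα₂ : α 2 s₂ = 1)
    (hα₀₁ : α 0 (κ * s₁) * α 1 (κ * s₀) = 1) (hα₁₂ : α 1 (κ * s₂) * α 2 (κ * s₁) = 1)
    (hαz : α 0 z = α 2 z) (hακ : α 0 κ = α 2 κ) :
    ∃ σ : G → G → kˣ,
      (∀ a b c : G, σ a b * σ (a * b) c = σ a (b * c) * σ b c) ∧
      ∀ i, σ (g i) κ * (σ κ (g i))⁻¹ * α i κ = 1 := by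
  have hsq : ∀ i, α i κ ^ 2 = 1 := fun i => by rw [← map_pow, hκ2, map_one]
  by_cases hab : α 0 κ = 1 ∧ α 1 κ = 1
  · refine ⟨fun _ _ => 1, by simp, fun i => ?_⟩
    fin_cases i
    · simpa using hab.1
    · simpa using hab.2
    · simpa [← hακ] using hab.1
  have hzs : z ^ 2 * s₀ = s₂ := by
    apply Subtype.ext
    push_cast
    rw [hz, hs₀, hs₂]
    have hc : Commute (g 2) (g 0)⁻¹ := Commute.inv_right h02.symm
    rw [hc.mul_pow]
    group
  obtain ⟨P, _, c, x, y, v, w, hinj, hc, hxy, hyv, hxv, hu, hwx, hwy, hwv⟩ :=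
    exists_group_relations (α 0 κ) (α 1 κ) (α 0 κ * α 1 s₀ * α 1 z)⁻¹ (α 0 z)⁻¹
      (α 0 κ * α 1 s₀) (hsq 0) (hsq 1) hab
  let c' : kˣ →* G × P := (MonoidHom.inr G P).comp c
  have hc' : ∀ (a : kˣ) (x : G × P), c' a * x = x * c' a := fun a x =>
    Prod.ext (by simp [c']) (by simpa [c'] using hc a x.2)
  let Q : Fin 3 → G × P := fun i => (g i, ![x, y, v] i)
  let K : G × P := (κ, w)
  have central : ∀ (m : Subgroup.center G) (x : G), x * m = m * x := fun m x =>
    Subgroup.mem_center_iff.1 m.2 x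
  have hQ01 : Q 0 * Q 1 = K * (Q 1 * Q 0) := Prod.ext h01 hxy
  have hQ12 : Q 1 * Q 2 = c' _ * (K * (Q 2 * Q 1)) := Prod.ext (by simpa [c'] using h12) hyv
  have hQ02 : CommutesUpTo c' (Q 0) (Q 2) _ := Prod.ext (by simpa [c'] using h02) hxv
  have hKK : K * K = c' _ := Prod.ext (by simpa [c', sq] using congrArg Subtype.val hκ2) hu
  have hKx : CommutesUpTo c' K (Q 0) _ := Prod.ext (by simpa [c'] using (central κ _).symm) hwx
  have hKy : CommutesUpTo c' K (Q 1) _ := Prod.ext (by simpa [c'] using (central κ _).symm) hwy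
  have hKv : CommutesUpTo c' K (Q 2) _ := Prod.ext (by simpa [c'] using (central κ _).symm) hwv
  have hmem : ∀ (W : G × P) (m : Subgroup.center G), W.1 = m →
      CommutesUpTo c' W (Q 0) (α 0 m) → CommutesUpTo c' W (Q 1) (α 1 m) →
      CommutesUpTo c' W (Q 2) (α 2 m) →
      W ∈ scalarCommutant (MonoidHom.fst G P) c' hc' Q α := by
    rintro ⟨_, p⟩ m rfl h0 h1 h2
    refine ⟨m.2, fun i => ?_⟩
    fin_cases i
    · exact h0
    · exact h1
    · exact h2
  have hK := hmem K κ rfl hKx hKy (hακ ▸ hKv)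
  have hQ01' : Q 0 * Q 1 = c' 1 * (K * (Q 1 * Q 0)) := by rw [hQ01]; simp
  have hQ10 : Q 1 * Q 0 = c' (α 0 κ * α 1 s₀)⁻¹ * (K * (Q 0 * Q 1)) := by
    rw [hQ01, ← mul_assoc K, hKK, map_inv]; group
  simp only [map_mul] at hα₀₁ hα₁₂
  have e1 : α 0 s₁ = (α 1 s₀)⁻¹ * (α 0 κ)⁻¹ * (α 1 κ)⁻¹ := by
    rw [← mul_inv, ← mul_inv, eq_inv_iff_mul_eq_one, ← hα₀₁]; ac_rfl
  have e2 : α 2 s₁ = (α 1 s₂)⁻¹ * (α 0 κ)⁻¹ * (α 1 κ)⁻¹ := by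
    rw [← mul_inv, ← mul_inv, eq_inv_iff_mul_eq_one, ← hα₁₂, hακ]; ac_rfl
  have e3 : ∀ i, α i s₂ = α i z * α i z * α i s₀ := fun i => by
    rw [← hzs, map_mul, map_pow, sq]
  have e4 : α 2 s₀ = (α 0 z)⁻¹ * (α 0 z)⁻¹ := by
    have := e3 2
    rw [hα₂, ← hαz] at this
    rw [← mul_inv, eq_inv_iff_mul_eq_one, mul_comm, ← this]
  have hval : ∀ {X Y : G × P} {a b : kˣ}, CommutesUpTo c' X Y a → a = b →
    CommutesUpTo c' X Y b := fun h e => e ▸ h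
  refine exists_cocycle_of_scalarCommutant (π := MonoidHom.fst G P) (c := c') (hc := hc') (Q := Q)
    (α := α) (K := K) (fun a b h => hinj (congrArg Prod.snd h)) (fun a => rfl) hgen
    (fun h => hκ1 (Subtype.ext h)) hQ01 hK
    (hmem _ s₀ (by simp [Q, hs₀, sq]) ?_ ?_ ?_) (hmem _ s₁ (by simp [Q, hs₁, sq]) ?_ ?_ ?_)
    (hmem _ z (by simp [Q, hz]) ?_ ?_ ?_)
  · exact hval ((CommutesUpTo.refl _).mul_left hc' (CommutesUpTo.refl _)) (by simp [hα₀])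
  · exact hval (CommutesUpTo.mul_self hc' hQ01' hKx hKK) (by simp)
  · exact hval (hQ02.mul_left hc' hQ02) e4.symm
  · exact hval (CommutesUpTo.mul_self hc' hQ10 hKy hKK) (by
      rw [e1]
      apply Units.ext
      push_cast
      field_simp)
  · exact hval ((CommutesUpTo.refl _).mul_left hc' (CommutesUpTo.refl _)) (by simp [hα₁])
  · exact hval (CommutesUpTo.mul_self hc' hQ12 hKy hKK) (by
      rw [e2, e3 1]
      apply Units.ext
      push_cast
      field_simp)
  · exact hval (hQ02.symm.mul_left hc' ((CommutesUpTo.refl _).inv_left hc')) (by simp)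
  · exact hval (CommutesUpTo.mul_inv_of_relations hc' hQ01 hQ12 hKK hKx hKv) (by
      simp only [mul_inv_rev, inv_inv]
      group)
  · exact hval ((CommutesUpTo.refl _).mul_left hc' (hQ02.inv_left hc')) (by simp [hαz])

theorem commute_sq_of_mul_eq {G : Type*} [Group G] {κ a b : G} (hκ : ∀ x : G, κ * x = x * κ)
    (hκ2 : κ ^ 2 = 1) (h : a * b = κ * (b * a)) : Commute (a ^ 2) b := by
  have : a ^ 2 * b = κ ^ 2 * (b * a ^ 2) := by
    rw [sq, mul_assoc, h, ← mul_assoc, ← hκ a, mul_assoc, ← mul_assoc a, h]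
    simp only [sq, mul_assoc]
  rwa [hκ2, one_mul] at this

/-- Type `α₃`: there is a 2-cocycle `σ` on `G` trivializing the action of `κ`
on the twisted characters. -/
theorem stmt_7 {k : Type*} [Field k] [IsAlgClosed k] [CharZero k]
    {G : Type*} [Group G] (κ g₁ g₂ g₃ : G)
    (hκc : ∀ x : G, κ * x = x * κ) (hκ1 : κ ≠ 1) (hκ2 : κ ^ 2 = 1)
    (hc₁ : ∀ x : G, x * g₁ * x⁻¹ = g₁ ∨ x * g₁ * x⁻¹ = κ * g₁)
    (hc₁' : ∃ x : G, x * g₁ * x⁻¹ = κ * g₁)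
    (hc₂ : ∀ x : G, x * g₂ * x⁻¹ = g₂ ∨ x * g₂ * x⁻¹ = κ * g₂)
    (hc₂' : ∃ x : G, x * g₂ * x⁻¹ = κ * g₂)
    (hc₃ : ∀ x : G, x * g₃ * x⁻¹ = g₃ ∨ x * g₃ * x⁻¹ = κ * g₃)
    (hc₃' : ∃ x : G, x * g₃ * x⁻¹ = κ * g₃)
    (hcomm₁₂ : g₁ * g₂ = κ * (g₂ * g₁))
    (hcomm₂₃ : g₂ * g₃ = κ * (g₃ * g₂))
    (hcomm₁₃ : g₁ * g₃ = g₃ * g₁)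
    (hgen : Subgroup.closure {g₁, g₂, g₃} = ⊤)
    (χ₁ : ↥(Subgroup.centralizer {g₁}) →* kˣ)
    (χ₂ : ↥(Subgroup.centralizer {g₂}) →* kˣ)
    (χ₃ : ↥(Subgroup.centralizer {g₃}) →* kˣ)
    (hχ₁ : ∀ hm : g₁ ∈ Subgroup.centralizer {g₁}, χ₁ ⟨g₁, hm⟩ = -1)
    (hχ₂ : ∀ hm : g₂ ∈ Subgroup.centralizer {g₂}, χ₂ ⟨g₂, hm⟩ = -1)
    (hχ₃ : ∀ hm : g₃ ∈ Subgroup.centralizer {g₃}, χ₃ ⟨g₃, hm⟩ = -1)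
    (hcompat₁₂ : ∀ (h₁ : κ * g₂ ^ 2 ∈ Subgroup.centralizer {g₁})
        (h₂ : κ * g₁ ^ 2 ∈ Subgroup.centralizer {g₂}),
      χ₁ ⟨κ * g₂ ^ 2, h₁⟩ * χ₂ ⟨κ * g₁ ^ 2, h₂⟩ = 1)
    (hcompat₂₃ : ∀ (h₁ : κ * g₃ ^ 2 ∈ Subgroup.centralizer {g₂})
        (h₂ : κ * g₂ ^ 2 ∈ Subgroup.centralizer {g₃}),
      χ₂ ⟨κ * g₃ ^ 2, h₁⟩ * χ₃ ⟨κ * g₂ ^ 2, h₂⟩ = 1)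
    (hcompat₁₃ : ∀ (h₁ : g₃ ∈ Subgroup.centralizer {g₁})
        (h₂ : g₁ ∈ Subgroup.centralizer {g₃}),
      χ₁ ⟨g₃, h₁⟩ * χ₃ ⟨g₁, h₂⟩ = 1)
    (hκ₁₃ : ∀ (h₁ : κ ∈ Subgroup.centralizer {g₁})
        (h₂ : κ ∈ Subgroup.centralizer {g₃}),
      χ₁ ⟨κ, h₁⟩ * χ₃ ⟨κ, h₂⟩ = 1) :
    ∃ σ : G → G → kˣ,
      (∀ a b c : G, σ a b * σ (a * b) c = σ a (b * c) * σ b c) ∧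
      (∀ hm : κ ∈ Subgroup.centralizer {g₁},
        σ g₁ κ * (σ κ g₁)⁻¹ * χ₁ ⟨κ, hm⟩ = 1) ∧
      (∀ hm : κ ∈ Subgroup.centralizer {g₂},
        σ g₂ κ * (σ κ g₂)⁻¹ * χ₂ ⟨κ, hm⟩ = 1) ∧
      (∀ hm : κ ∈ Subgroup.centralizer {g₃},
        σ g₃ κ * (σ κ g₃)⁻¹ * χ₃ ⟨κ, hm⟩ = 1) := by
  have hκκ : κ * κ = 1 := by rw [← sq, hκ2]
  have swap : ∀ {a b : G}, a * b = κ * (b * a) → b * a = κ * (a * b) := fun h => by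
    rw [h, ← mul_assoc, hκκ, one_mul]
  have center : ∀ m : G, Commute m g₁ → Commute m g₂ → Commute m g₃ →
      m ∈ Subgroup.center G := fun m h₁ h₂ h₃ => by
    have hle : Subgroup.closure {g₁, g₂, g₃} ≤ Subgroup.centralizer {m} := by
      rw [Subgroup.closure_le]
      rintro _ (rfl | rfl | rfl)
      · exact Subgroup.mem_centralizer_singleton_iff.2 h₁.symm
      · exact Subgroup.mem_centralizer_singleton_iff.2 h₂.symm
      · exact Subgroup.mem_centralizer_singleton_iff.2 h₃.symm
    rw [hgen] at hle
    exact Subgroup.mem_center_iff.2 fun x =>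
      Subgroup.mem_centralizer_singleton_iff.1 (hle (Subgroup.mem_top x))
  have comm₁₃ : Commute g₁ g₃ := hcomm₁₃
  have hs₁ : g₁ ^ 2 ∈ Subgroup.center G := center _ ((Commute.refl g₁).pow_left 2)
    (commute_sq_of_mul_eq hκc hκ2 hcomm₁₂) (comm₁₃.pow_left 2)
  have hs₂ : g₂ ^ 2 ∈ Subgroup.center G := center _
    (commute_sq_of_mul_eq hκc hκ2 (swap hcomm₁₂)) ((Commute.refl g₂).pow_left 2)
    (commute_sq_of_mul_eq hκc hκ2 hcomm₂₃)
  have hs₃ : g₃ ^ 2 ∈ Subgroup.center G := center _ (comm₁₃.symm.pow_left 2)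
    (commute_sq_of_mul_eq hκc hκ2 (swap hcomm₂₃)) ((Commute.refl g₃).pow_left 2)
  have hz : g₃ * g₁⁻¹ ∈ Subgroup.center G := by
    refine center _ (comm₁₃.symm.mul_left (Commute.refl g₁).inv_left) ?_
      ((Commute.refl g₃).mul_left comm₁₃.inv_left)
    have h : g₁⁻¹ * g₂ = κ * (g₂ * g₁⁻¹) := by
      rw [inv_mul_eq_iff_eq_mul, ← mul_assoc, ← hκc, mul_assoc, ← mul_assoc g₁, hcomm₁₂,
        ← mul_assoc, ← mul_assoc, hκκ, one_mul, mul_inv_cancel_right]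
    calc g₃ * g₁⁻¹ * g₂ = g₃ * κ * (g₂ * g₁⁻¹) := by rw [mul_assoc, h, mul_assoc]
      _ = κ * (g₃ * g₂) * g₁⁻¹ := by rw [← hκc]; group
      _ = g₂ * (g₃ * g₁⁻¹) := by rw [← hcomm₂₃, mul_assoc]
  have self : ∀ x : G, x ∈ Subgroup.centralizer {x} := fun x =>
    Subgroup.mem_centralizer_singleton_iff.2 rfl
  have h₃₁ : g₃ ∈ Subgroup.centralizer {g₁} :=
    Subgroup.mem_centralizer_singleton_iff.2 hcomm₁₃.symm
  have h₁₃ : g₁ ∈ Subgroup.centralizer {g₃} :=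
    Subgroup.mem_centralizer_singleton_iff.2 hcomm₁₃
  let incl : ∀ x : G, Subgroup.center G →* Subgroup.centralizer {x} := fun x =>
    Subgroup.inclusion (Subgroup.center_le_centralizer {x})
  let κ' : Subgroup.center G := ⟨κ, Subgroup.mem_center_iff.2 fun x => (hκc x).symm⟩
  have hκ'2 : κ' ^ 2 = 1 := Subtype.ext hκ2
  have eval_sq : ∀ (x : G) (hx : x ^ 2 ∈ Subgroup.center G)
      (χ : ↥(Subgroup.centralizer {x}) →* kˣ), χ ⟨x, self x⟩ = -1 →
      χ (incl x ⟨x ^ 2, hx⟩) = 1 := fun x hx χ h => by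
    have e : incl x ⟨x ^ 2, hx⟩ = ⟨x, self x⟩ ^ 2 := rfl
    rw [e, map_pow, h, neg_one_sq]
  have hακ : χ₁ (incl g₁ κ') = χ₃ (incl g₃ κ') := by
    have h : χ₁ (incl g₁ κ') * χ₃ (incl g₃ κ') = 1 := hκ₁₃ _ _
    have h' : χ₃ (incl g₃ κ') * χ₃ (incl g₃ κ') = 1 := by
      rw [← map_mul, ← map_mul, ← sq, hκ'2, map_one, map_one]
    exact mul_right_cancel (h.trans h'.symm)
  have hαz : χ₁ (incl g₁ ⟨_, hz⟩) = χ₃ (incl g₃ ⟨_, hz⟩) := by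
    have e₁ : incl g₁ ⟨_, hz⟩ = ⟨g₃, h₃₁⟩ * ⟨g₁, self g₁⟩⁻¹ := rfl
    have e₃ : incl g₃ ⟨_, hz⟩ = ⟨g₃, self g₃⟩ * ⟨g₁, h₁₃⟩⁻¹ := rfl
    rw [e₁, e₃, map_mul, map_mul, map_inv, map_inv, hχ₁, hχ₃,
      eq_inv_of_mul_eq_one_left (hcompat₁₃ h₃₁ h₁₃), mul_comm, inv_neg_one]
  have hrange : ({g₁, g₂, g₃} : Set G) = Set.range ![g₁, g₂, g₃] := by
    ext x
    simp [eq_comm, or_comm, or_left_comm]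
  obtain ⟨σ, hσ, hσκ⟩ := exists_cocycle_of_center_characters ![g₁, g₂, g₃]
    (hrange ▸ hgen)
    κ'
    ⟨_, hs₁⟩ ⟨_, hs₂⟩ ⟨_, hs₃⟩ ⟨_, hz⟩
    (fun h => hκ1 (congrArg Subtype.val h)) hκ'2 hcomm₁₂ hcomm₂₃ hcomm₁₃ rfl rfl rfl rfl
    ![χ₁.comp (incl g₁), χ₂.comp (incl g₂), χ₃.comp (incl g₃)]
    (eval_sq g₁ hs₁ χ₁ (hχ₁ _)) (eval_sq g₂ hs₂ χ₂ (hχ₂ _)) (eval_sq g₃ hs₃ χ₃ (hχ₃ _))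
    (hcompat₁₂ _ _) (hcompat₂₃ _ _) hαz hακ
  exact ⟨σ, hσ, fun _ => hσκ 0, fun _ => hσκ 1, fun _ => hσκ 2⟩
end

section
/- Let G be a group, κ ∈ G central with κ ≠ 1 and κ² = 1. Let g₁, g₂ ∈ G have conjugacy classes {g₁, κ·g₁} and {g₂, κ·g₂} with g₁·g₂ = κ·g₂·g₁, let g₃ ∈ G be central, and suppose G is generated by g₁, g₂, g₃. Let χ₁ : C_G(g₁) → kˣ, χ₂ : C_G(g₂) → kˣ and χ₃ : G → kˣ be group homomorphisms with χ_i(g_i) = −1 for i = 1, 2, 3, satisfying χ₁(κ·g₂²)·χ₂(κ·g₁²) = 1, χ₁(g₃)·χ₃(g₁) = 1 and χ₂(g₃)·χ₃(g₂) = −1 (the conditions defining a Yetter–Drinfeld module of type γ₃ whose support generates G). Then there exists a 2-cocycle σ on G with values in kˣ such that σ(g_i, κ)·σ(κ, g_i)⁻¹·χ_i(κ) = 1 for i = 1, 2, 3. -/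
/-- An injective homomorphism from the units of an algebraically closed field of characteristic
zero into a commutative group has a retraction. -/
theorem exists_retraction_of_units {k : Type*} [Field k] [IsAlgClosed k] [CharZero k]
    {A : Type*} [Group A] [IsMulCommutative A] (s : kˣ →* A) (hs : Function.Injective s) :
    ∃ r : A →* kˣ, ∀ u, r (s u) = u := by
  have hroot : ∀ {n : ℤ}, n ≠ 0 →
      Function.Surjective (fun a : Additive kˣ => n • a) := by
    have hnat : ∀ (n : ℕ), n ≠ 0 → ∀ u : kˣ, ∃ v : kˣ, v ^ n = u := by
      intro n hn u
      obtain ⟨z, hz⟩ := IsAlgClosed.exists_pow_nat_eq (u : k) (Nat.pos_of_ne_zero hn)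
      have hz0 : z ≠ 0 := by
        rintro rfl
        rw [zero_pow hn] at hz
        exact u.ne_zero hz.symm
      exact ⟨Units.mk0 z hz0, Units.ext (by simpa using hz)⟩
    intro n hn u
    obtain ⟨m, rfl | rfl⟩ := n.eq_nat_or_neg
    all_goals obtain ⟨v, hv⟩ := hnat m (by simpa using hn) u.toMul
    · exact ⟨Additive.ofMul v, Additive.toMul.injective (by simpa using hv)⟩
    · exact ⟨Additive.ofMul v⁻¹, Additive.toMul.injective (by simpa using hv)⟩
  let _ : CommGroup A := { mul_comm := mul_comm' }
  let _ : DivisibleBy (Additive kˣ) ℤ := divisibleByOfSMulRightSurj _ _ hroot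
  obtain ⟨r, hr⟩ := (Module.Baer.of_divisible (Additive kˣ)).extension_property_addMonoidHom
    (MonoidHom.toAdditive s) hs (AddMonoidHom.id _)
  exact ⟨MonoidHom.toAdditive.symm r, fun u => DFunLike.congr_fun hr (Additive.ofMul u)⟩

/-- Normal form for elements of a group generated by `x`, `y` and `w`, where `w` is central and
the commutator `z` of `x` and `y` is central. -/
theorem exists_zpow_of_mem_closure {M : Type*} [Group M] {x y w z : M}
    (hxy : x * y = z * (y * x)) (hzx : Commute z x) (hzy : Commute z y) (hzw : Commute z w)
    (hwx : Commute w x) (hwy : Commute w y) {m : M} (hm : m ∈ Subgroup.closure {x, y, w}) :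
    ∃ a b c d : ℤ, m = x ^ a * y ^ b * w ^ c * z ^ d := by
  have h1 : SemiconjBy x y (z * y) := by simp [SemiconjBy, hxy, mul_assoc]
  have h2 (b : ℤ) : x * y ^ b = y ^ b * z ^ b * x := by
    rw [(hzy.zpow_zpow b b).symm.eq, ← hzy.mul_zpow]
    exact (h1.zpow_right b).eq
  have h3 (b : ℤ) : y ^ b * x⁻¹ = x⁻¹ * (y ^ b * z ^ b) := by
    rw [eq_inv_mul_iff_mul_eq, ← mul_assoc, h2, mul_inv_cancel_right]
  have h4 (b : ℤ) : y ^ b * x = x * (y ^ b * z ^ (-b)) := by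
    rw [← mul_assoc, h2, mul_assoc, mul_assoc, ← (hzx.zpow_left _).eq, zpow_neg,
      mul_inv_cancel_left]
  induction hm using Subgroup.closure_induction_right with
  | one => exact ⟨0, 0, 0, 0, by simp⟩
  | mul_right m _ g hg ih =>
    obtain ⟨a, b, c, d, rfl⟩ := ih
    obtain rfl | rfl | rfl := hg
    · refine ⟨a + 1, b, c, d - b, ?_⟩
      calc _ = g ^ a * (y ^ b * g) * w ^ c * z ^ d := by
            simp only [mul_assoc, (hzx.zpow_left d).eq, (hwx.zpow_left c).left_comm]
        _ = _ := by
          rw [h4]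
          simp only [mul_assoc, zpow_add, zpow_one, sub_eq_neg_add]
          rw [(hzw.zpow_zpow (-b) c).left_comm]
    · refine ⟨a, b + 1, c, d, ?_⟩
      simp only [mul_assoc, (hzy.zpow_left d).eq, (hwy.zpow_left c).left_comm, zpow_add, zpow_one]
    · refine ⟨a, b, c + 1, d, ?_⟩
      simp only [mul_assoc, (hzw.zpow_left d).eq, zpow_add, zpow_one]
  | mul_inv_cancel m _ g hg ih =>
    obtain ⟨a, b, c, d, rfl⟩ := ih
    obtain rfl | rfl | rfl := hg
    · refine ⟨a + -1, b, c, d + b, ?_⟩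
      calc _ = g ^ a * (y ^ b * g⁻¹) * w ^ c * z ^ d := by
            simp only [mul_assoc, (hzx.zpow_left d).inv_right.eq,
              (hwx.zpow_left c).inv_right.left_comm]
        _ = _ := by
          rw [h3]
          simp only [mul_assoc, zpow_add, zpow_neg_one, add_comm d b]
          rw [(hzw.zpow_zpow b c).left_comm]
    · refine ⟨a, b + -1, c, d, ?_⟩
      simp only [mul_assoc, (hzy.zpow_left d).inv_right.eq, (hwy.zpow_left c).inv_right.left_comm,
        zpow_add, zpow_neg_one]
    · refine ⟨a, b, c + -1, d, ?_⟩
      simp only [mul_assoc, (hzw.zpow_left d).inv_right.eq, zpow_add, zpow_neg_one]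

/-- If the relation `P` lifts elements of `G` to elements of `E`, uniquely up to central elements,
then pushing the defect of multiplicativity of a section along a homomorphism `r` from the center
of `E` gives a 2-cocycle, whose alternation on commuting elements is computed by commutators. -/
theorem exists_cocycle_of_lift {G E A : Type*} [Group G] [Group E] [CommGroup A]
    (P : Subgroup (G × E)) (hsurj : ∀ g, ∃ e, (g, e) ∈ P)
    (hker : ∀ e, (1, e) ∈ P → e ∈ Subgroup.center E)
    (r : Subgroup.center E →* A) :
    ∃ σ : G → G → A, (∀ a b c, σ a b * σ (a * b) c = σ a (b * c) * σ b c) ∧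
      ∀ a b : G, ∀ e f : E, (a, e) ∈ P → (b, f) ∈ P → a * b = b * a →
        ∀ u : Subgroup.center E, e * f = u * (f * e) → σ a b * (σ b a)⁻¹ = r u := by
  choose t ht using hsurj
  have hn : ∀ a b, t a * t b * (t (a * b))⁻¹ ∈ Subgroup.center E := fun a b => by
    apply hker
    simpa using P.mul_mem (P.mul_mem (ht a) (ht b)) (P.inv_mem (ht (a * b)))
  refine ⟨fun a b => r ⟨_, hn a b⟩, fun a b c => ?_, fun a b e f he hf hab u hu => ?_⟩
  · rw [← map_mul, ← map_mul]
    congr 1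
    apply Subtype.ext
    have h := Subgroup.mem_center_iff.1 (hn b c) (t (b * c) * (t (a * (b * c)))⁻¹)
    calc t a * t b * (t (a * b))⁻¹ * (t (a * b) * t c * (t (a * b * c))⁻¹)
        = t a * (t b * t c * (t (b * c))⁻¹ * (t (b * c) * (t (a * (b * c)))⁻¹)) := by
          rw [mul_assoc a b c]; group
      _ = t a * t (b * c) * (t (a * (b * c)))⁻¹ * (t b * t c * (t (b * c))⁻¹) := by
          rw [← h]; group
  · rw [← map_inv, ← map_mul]
    congr 1
    apply Subtype.ext
    have key : ∀ g e, (g, e) ∈ P → ∃ v ∈ Subgroup.center E, t g = e * v := fun g e he =>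
      ⟨e⁻¹ * t g, hker _ (by simpa using P.mul_mem (P.inv_mem he) (ht g)), by group⟩
    obtain ⟨v, hv, hav⟩ := key a e he
    obtain ⟨w, hw, hbw⟩ := key b f hf
    rw [Subgroup.mem_center_iff] at hv hw
    have h1 : t a * t b = u * (t b * t a) := by
      calc t a * t b = e * (v * f) * w := by rw [hav, hbw]; group
        _ = e * f * (v * w) := by rw [← hv]; group
        _ = u * (f * (e * w)) * v := by rw [hu, hw v]; group
        _ = u * (t b * t a) := by rw [hw, hav, hbw]; group
    simp only [Subgroup.coe_mul, Subgroup.coe_inv, hab, h1]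
    group

/-- The permutation of `ℤ × ℤ × A` translating the first two coordinates by `m` and `n` and
multiplying the third one by `f`. -/
def shiftPerm {A : Type*} [CommGroup A] (m n : ℤ) (f : ℤ → ℤ → A) :
    Equiv.Perm (ℤ × ℤ × A) where
  toFun p := (p.1 + m, p.2.1 + n, f p.1 p.2.1 * p.2.2)
  invFun p := (p.1 - m, p.2.1 - n, (f (p.1 - m) (p.2.1 - n))⁻¹ * p.2.2)
  left_inv p := by simp
  right_inv p := by simp

theorem shiftPerm_mul {A : Type*} [CommGroup A] (m n m' n' : ℤ) (f f' : ℤ → ℤ → A) :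
    shiftPerm m n f * shiftPerm m' n' f' =
      shiftPerm (m + m') (n + n') fun a b => f (a + m') (b + n') * f' a b := by
  ext ⟨a, b, u⟩ <;> simp [shiftPerm, mul_assoc] <;> ring

/-- A central extension, by an abelian group `A`, of the group generated by `x`, `y`, `w` and `z`
with `z` of order two, `z` and `w` central and `x * y = z * (y * x)`. -/
theorem exists_central_extension.{u} {A : Type u} [CommGroup A] (μ ε₁ ε₂ α β : A)
    (hε₁ : ε₁ ^ 2 = 1) (hε₂ : ε₂ ^ 2 = 1) :
    ∃ (E : Type u) (_ : Group E) (s : A →* E) (x y w z : E),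
      Function.Injective s ∧ (∀ u, s u ∈ Subgroup.center E) ∧
      (∀ v, Commute v x → Commute v y → Commute v w → v ∈ Subgroup.center E) ∧
      SemiconjBy x z (s ε₁ * z) ∧ SemiconjBy y z (s ε₂ * z) ∧ Commute w z ∧
      x * y = z * (y * x) ∧ z ^ 2 = s (μ ^ 2) ∧
      SemiconjBy x w (s α * w) ∧ SemiconjBy y w (s β * w) := by
  have hT (b : ℤ) : (b + 1) * (b + 1 + 1) / 2 = b * (b + 1) / 2 + (b + 1) := by
    rw [show (b + 1) * (b + 1 + 1) = b * (b + 1) + (b + 1) * 2 by ring,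
      Int.add_mul_ediv_right _ _ two_ne_zero]
  let s : A →* Equiv.Perm (ℤ × ℤ × A) :=
    { toFun u := shiftPerm 0 0 fun _ _ => u
      map_one' := by ext <;> simp [shiftPerm]
      map_mul' u v := by rw [shiftPerm_mul]; simp }
  have hs : ∀ u, s u = shiftPerm 0 0 fun _ _ => u := fun _ => rfl
  let x : Equiv.Perm (ℤ × ℤ × A) :=
    shiftPerm 1 0 fun a b => (μ * ε₁ ^ (a + 1)) ^ b * ε₂ ^ (b * (b + 1) / 2)
  let y : Equiv.Perm (ℤ × ℤ × A) := shiftPerm 0 1 1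
  let w : Equiv.Perm (ℤ × ℤ × A) := shiftPerm 0 0 fun a b => α ^ (-a) * β ^ (-b)
  let z : Equiv.Perm (ℤ × ℤ × A) := shiftPerm 0 0 fun a b => μ * ε₁ ^ a * ε₂ ^ b
  have hinj : Function.Injective s := fun u v huv => by
    simpa [hs, shiftPerm] using DFunLike.congr_fun huv (0, 0, 1)
  have hsc (u : A) (m n : ℤ) (f : ℤ → ℤ → A) : Commute (s u) (shiftPerm m n f) := by
    simp [Commute, SemiconjBy, hs, shiftPerm_mul, mul_comm]
  have hi₁ : ε₁ * ε₁ = 1 := by rw [← pow_two, hε₁]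
  have hi₂ : ε₂ * ε₂ = 1 := by rw [← pow_two, hε₂]
  have hxz : SemiconjBy x z (s ε₁ * z) := by
    simp only [SemiconjBy, hs, shiftPerm_mul, x, z]
    congr 1
    funext a b
    simp only [add_zero, zpow_add, zpow_one]
    rw [show ε₁ * (μ * (ε₁ ^ a * ε₁) * ε₂ ^ b) = (ε₁ * ε₁) * (μ * ε₁ ^ a * ε₂ ^ b) by
      ac_rfl, hi₁, one_mul, mul_comm]
  have hyz : SemiconjBy y z (s ε₂ * z) := by
    simp only [SemiconjBy, hs, shiftPerm_mul, y, z]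
    congr 1
    funext a b
    simp only [add_zero, zpow_add, zpow_one, Pi.one_apply, one_mul, mul_one]
    rw [show ε₂ * (μ * ε₁ ^ a * (ε₂ ^ b * ε₂)) = (ε₂ * ε₂) * (μ * ε₁ ^ a * ε₂ ^ b) by
      ac_rfl, hi₂, one_mul]
  have hwz : Commute w z := by
    simp [Commute, SemiconjBy, shiftPerm_mul, mul_comm, w, z]
  have hxy : x * y = z * (y * x) := by
    simp only [shiftPerm_mul, x, y, z]
    congr 1
    funext a b
    simp only [add_zero, zero_add, hT, Pi.one_apply, one_mul, mul_one]
    rw [zpow_add _ b 1, zpow_add _ (b * (b + 1) / 2) (b + 1), zpow_one]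
    ac_rfl
  have hz : z ^ 2 = s (μ ^ 2) := by
    rw [pow_two, hs]
    simp only [shiftPerm_mul, z]
    congr 1
    funext a b
    have h₁ : ε₁ ^ a * ε₁ ^ a = 1 := by rw [← mul_zpow, hi₁, one_zpow]
    have h₂ : ε₂ ^ b * ε₂ ^ b = 1 := by rw [← mul_zpow, hi₂, one_zpow]
    simp only [add_zero]
    rw [mul_mul_mul_comm, h₂, mul_mul_mul_comm, h₁, pow_two, mul_one, mul_one]
  have hxw : SemiconjBy x w (s α * w) := by
    simp only [SemiconjBy, hs, shiftPerm_mul, x, w]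
    congr 1
    funext a b
    simp only [add_zero, neg_add, zpow_add, zpow_neg_one]
    rw [show α * (α ^ (-a) * α⁻¹ * β ^ (-b)) = α ^ (-a) * β ^ (-b) by
      rw [mul_comm _ α⁻¹, mul_assoc α⁻¹, mul_inv_cancel_left], mul_comm]
  have hyw : SemiconjBy y w (s β * w) := by
    simp only [SemiconjBy, hs, shiftPerm_mul, y, w]
    congr 1
    funext a b
    simp only [add_zero, neg_add, zpow_add, zpow_neg_one, Pi.one_apply, one_mul, mul_one]
    rw [mul_left_comm, mul_comm _ β⁻¹, mul_inv_cancel_left]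
  let E := Subgroup.closure ({x, y, w} ∪ Set.range s)
  have hxE : x ∈ E := Subgroup.subset_closure (by simp)
  have hyE : y ∈ E := Subgroup.subset_closure (by simp)
  have hwE : w ∈ E := Subgroup.subset_closure (by simp)
  have hsE (u : A) : s u ∈ E := Subgroup.subset_closure (by simp)
  have hzE : z ∈ E := by
    rw [← mul_inv_eq_iff_eq_mul.2 hxy]
    exact E.mul_mem (E.mul_mem hxE hyE) (E.inv_mem (E.mul_mem hyE hxE))
  have hcomm (v : Equiv.Perm (ℤ × ℤ × A)) (h₁ : Commute v x) (h₂ : Commute v y)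
      (h₃ : Commute v w) (h₄ : ∀ u, Commute v (s u)) (g : E) : Commute v g := by
    have : E ≤ Subgroup.centralizer {v} := by
      rw [Subgroup.closure_le]
      rintro _ ((rfl | rfl | rfl) | ⟨u, rfl⟩)
      exacts [Subgroup.mem_centralizer_singleton_iff.2 h₁.symm.eq,
        Subgroup.mem_centralizer_singleton_iff.2 h₂.symm.eq,
        Subgroup.mem_centralizer_singleton_iff.2 h₃.symm.eq,
        Subgroup.mem_centralizer_singleton_iff.2 (h₄ u).symm.eq]
    exact (Subgroup.mem_centralizer_singleton_iff.1 (this g.2)).symm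
  have hscE (u : A) (g : E) : Commute (s u) g :=
    hcomm _ (hsc u _ _ _) (hsc u _ _ _) (hsc u _ _ _) (fun v => hsc u _ _ _) g
  refine ⟨E, inferInstance, s.codRestrict E hsE, ⟨x, hxE⟩, ⟨y, hyE⟩, ⟨w, hwE⟩, ⟨z, hzE⟩,
    fun u v huv => hinj (congrArg Subtype.val huv), fun u => ?_, fun v h₁ h₂ h₃ => ?_,
    Subtype.ext hxz.eq, Subtype.ext hyz.eq, Subtype.ext hwz.eq, Subtype.ext hxy, Subtype.ext hz,
    Subtype.ext hxw.eq, Subtype.ext hyw.eq⟩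
  · exact Subgroup.mem_center_iff.2 fun g => Subtype.ext (hscE u g).symm
  · exact Subgroup.mem_center_iff.2 fun g => Subtype.ext (hcomm v (congrArg Subtype.val h₁)
      (congrArg Subtype.val h₂) (congrArg Subtype.val h₃) (fun u => (hscE u v).symm) g).symm

/-- The relations between the scalars attached to a relation in the group force the exponent of
the third generator to be even. -/
theorem even_of_relations {k : Type*} [Field k] [CharZero k] {p q A B ε₁ ε₂ : kˣ} {a b c d : ℤ}
    (hpq : p * q = ε₁ * ε₂) (hε₁ : ε₁ ^ 2 = 1) (hε₂ : ε₂ ^ 2 = 1)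
    (h₁ : p ^ b * (A⁻¹) ^ c * ε₁ ^ d = 1) (h₂ : q ^ a * (-B⁻¹) ^ c * ε₂ ^ d = 1)
    (h₃ : A ^ (2 * a) * B ^ (2 * b) * (-1) ^ c = 1) : Even c := by
  by_contra hc
  rw [Int.not_even_iff_odd] at hc
  have e2 (e : kˣ) (he : e ^ 2 = 1) (n : ℤ) : e ^ (2 * n) = 1 := by
    rw [zpow_mul]; simp [he]
  have h4 : p ^ (2 * a * b) = A ^ (2 * a * c) := by
    have h : (p ^ b * (A⁻¹) ^ c * ε₁ ^ d) ^ (2 * a) = 1 := by rw [h₁, one_zpow]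
    rw [mul_zpow, mul_zpow, ← zpow_mul ε₁, show d * (2 * a) = 2 * (d * a) by ring, e2 _ hε₁,
      mul_one, inv_zpow, inv_zpow, mul_inv_eq_one, ← zpow_mul, ← zpow_mul] at h
    rw [show 2 * a * b = b * (2 * a) by ring, h]; ring_nf
  have h5 : q ^ (2 * a * b) = B ^ (2 * b * c) := by
    have h : (q ^ a * (-B⁻¹) ^ c * ε₂ ^ d) ^ (2 * b) = 1 := by rw [h₂, one_zpow]
    rw [mul_zpow, mul_zpow, ← zpow_mul ε₂, show d * (2 * b) = 2 * (d * b) by ring, e2 _ hε₂,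
      mul_one, ← zpow_mul (-B⁻¹), (show Even (c * (2 * b)) by simp).neg_zpow, inv_zpow,
      mul_inv_eq_one, ← zpow_mul] at h
    rw [show 2 * a * b = a * (2 * b) by ring, h]; ring_nf
  have h6 : (A ^ (2 * a) * B ^ (2 * b)) ^ c = 1 := by
    rw [mul_zpow, ← zpow_mul, ← zpow_mul, ← h4, ← h5, ← mul_zpow, hpq, mul_assoc 2 a b,
      mul_zpow, e2 _ hε₁, e2 _ hε₂, one_mul]
  rw [hc.neg_one_zpow, mul_neg_one, neg_eq_iff_eq_neg] at h₃
  rw [h₃, hc.neg_one_zpow] at h6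
  have h7 := congrArg Units.val h6
  norm_num at h7

theorem SemiconjBy.mul_scalar {E A : Type*} [Group E] [CommGroup A] {s : A →* E}
    (hs : ∀ u, s u ∈ Subgroup.center E) {h v v' : E} {p p' : A}
    (hv : SemiconjBy h v (s p * v)) (hv' : SemiconjBy h v' (s p' * v')) :
    SemiconjBy h (v * v') (s (p * p') * (v * v')) := by
  have := hv.mul_right hv'
  rwa [mul_assoc, ← mul_assoc v, Subgroup.mem_center_iff.1 (hs p') v, mul_assoc, ← mul_assoc,
    ← map_mul] at this

theorem SemiconjBy.zpow_scalar {E A : Type*} [Group E] [CommGroup A] {s : A →* E}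
    (hs : ∀ u, s u ∈ Subgroup.center E) {h v : E} {p : A}
    (hv : SemiconjBy h v (s p * v)) (n : ℤ) : SemiconjBy h (v ^ n) (s (p ^ n) * v ^ n) := by
  have := hv.zpow_right n
  rwa [Commute.mul_zpow (Subgroup.mem_center_iff.1 (hs p) v).symm, ← map_zpow] at this

theorem SemiconjBy.pow_scalar {E A : Type*} [Group E] [CommGroup A] {s : A →* E}
    (hs : ∀ u, s u ∈ Subgroup.center E) {h v : E} {p : A}
    (hv : SemiconjBy h v (s p * v)) (n : ℕ) : SemiconjBy h (v ^ n) (s (p ^ n) * v ^ n) := by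
  have := hv.zpow_scalar hs n
  rwa [zpow_natCast, zpow_natCast] at this

theorem SemiconjBy.symm_scalar {E A : Type*} [Group E] [CommGroup A] {s : A →* E}
    {h v : E} {p : A} (hv : SemiconjBy h v (s p * v)) : SemiconjBy v h (s p⁻¹ * h) := by
  rw [SemiconjBy, mul_assoc, hv.eq, mul_assoc, ← mul_assoc, ← map_mul, inv_mul_cancel, map_one,
    one_mul]

theorem even_of_zpow_eq_one {G : Type*} [Group G] {κ : G} (h1 : κ ≠ 1) (h2 : κ ^ 2 = 1) {n : ℤ}
    (hn : κ ^ n = 1) : Even n := by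
  by_contra hodd
  obtain ⟨m, rfl⟩ := Int.not_even_iff_odd.1 hodd
  rw [zpow_add, zpow_mul, zpow_one, zpow_ofNat, h2, one_zpow, one_mul] at hn
  exact h1 hn

/-- Type `γ₃`: there is a 2-cocycle `σ` on `G` trivializing the action of `κ`
on the twisted characters. -/
theorem stmt_8 {k : Type*} [Field k] [IsAlgClosed k] [CharZero k]
    {G : Type*} [Group G] (κ g₁ g₂ g₃ : G)
    (hκc : ∀ x : G, κ * x = x * κ) (hκ1 : κ ≠ 1) (hκ2 : κ ^ 2 = 1)
    (hc₁ : ∀ x : G, x * g₁ * x⁻¹ = g₁ ∨ x * g₁ * x⁻¹ = κ * g₁)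
    (hc₁' : ∃ x : G, x * g₁ * x⁻¹ = κ * g₁)
    (hc₂ : ∀ x : G, x * g₂ * x⁻¹ = g₂ ∨ x * g₂ * x⁻¹ = κ * g₂)
    (hc₂' : ∃ x : G, x * g₂ * x⁻¹ = κ * g₂)
    (hcomm₁₂ : g₁ * g₂ = κ * (g₂ * g₁))
    (hg₃c : ∀ x : G, g₃ * x = x * g₃)
    (hgen : Subgroup.closure {g₁, g₂, g₃} = ⊤)
    (χ₁ : ↥(Subgroup.centralizer {g₁}) →* kˣ)
    (χ₂ : ↥(Subgroup.centralizer {g₂}) →* kˣ)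
    (χ₃ : G →* kˣ)
    (hχ₁ : ∀ hm : g₁ ∈ Subgroup.centralizer {g₁}, χ₁ ⟨g₁, hm⟩ = -1)
    (hχ₂ : ∀ hm : g₂ ∈ Subgroup.centralizer {g₂}, χ₂ ⟨g₂, hm⟩ = -1)
    (hχ₃ : χ₃ g₃ = -1)
    (hcompat₁₂ : ∀ (h₁ : κ * g₂ ^ 2 ∈ Subgroup.centralizer {g₁})
        (h₂ : κ * g₁ ^ 2 ∈ Subgroup.centralizer {g₂}),
      χ₁ ⟨κ * g₂ ^ 2, h₁⟩ * χ₂ ⟨κ * g₁ ^ 2, h₂⟩ = 1)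
    (hcompat₁₃ : ∀ h₁ : g₃ ∈ Subgroup.centralizer {g₁},
      χ₁ ⟨g₃, h₁⟩ * χ₃ g₁ = 1)
    (hcompat₂₃ : ∀ h₁ : g₃ ∈ Subgroup.centralizer {g₂},
      χ₂ ⟨g₃, h₁⟩ * χ₃ g₂ = -1) :
    ∃ σ : G → G → kˣ,
      (∀ a b c : G, σ a b * σ (a * b) c = σ a (b * c) * σ b c) ∧
      (∀ hm : κ ∈ Subgroup.centralizer {g₁},
        σ g₁ κ * (σ κ g₁)⁻¹ * χ₁ ⟨κ, hm⟩ = 1) ∧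
      (∀ hm : κ ∈ Subgroup.centralizer {g₂},
        σ g₂ κ * (σ κ g₂)⁻¹ * χ₂ ⟨κ, hm⟩ = 1) ∧
      σ g₃ κ * (σ κ g₃)⁻¹ * χ₃ κ = 1 := by
  have hκ₁ : κ ∈ Subgroup.centralizer {g₁} := Subgroup.mem_centralizer_singleton_iff.2 (hκc g₁)
  have hκ₂ : κ ∈ Subgroup.centralizer {g₂} := Subgroup.mem_centralizer_singleton_iff.2 (hκc g₂)
  have hg₃₁ : g₃ ∈ Subgroup.centralizer {g₁} := Subgroup.mem_centralizer_singleton_iff.2 (hg₃c g₁)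
  have hg₃₂ : g₃ ∈ Subgroup.centralizer {g₂} := Subgroup.mem_centralizer_singleton_iff.2 (hg₃c g₂)
  have hg₁₁ : g₁ ∈ Subgroup.centralizer {g₁} := Subgroup.mem_centralizer_singleton_iff.2 rfl
  have hg₂₂ : g₂ ∈ Subgroup.centralizer {g₂} := Subgroup.mem_centralizer_singleton_iff.2 rfl
  have hs₁ : SemiconjBy g₁ g₂ (κ * g₂) := by rw [SemiconjBy, hcomm₁₂, mul_assoc]
  have hs₂ : SemiconjBy g₂ g₁ (κ * g₁) := by
    rw [SemiconjBy, mul_assoc, hcomm₁₂, ← mul_assoc, ← pow_two, hκ2, one_mul]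
  have hsq₁ : SemiconjBy g₁ (g₂ ^ 2) (g₂ ^ 2) := by
    simpa [Commute.mul_pow (hκc g₂), hκ2] using hs₁.pow_right 2
  have hsq₂ : SemiconjBy g₂ (g₁ ^ 2) (g₁ ^ 2) := by
    simpa [Commute.mul_pow (hκc g₁), hκ2] using hs₂.pow_right 2
  have hq₁ : g₂ ^ 2 ∈ Subgroup.centralizer {g₁} :=
    Subgroup.mem_centralizer_singleton_iff.2 hsq₁.eq.symm
  have hq₂ : g₁ ^ 2 ∈ Subgroup.centralizer {g₂} :=
    Subgroup.mem_centralizer_singleton_iff.2 hsq₂.eq.symm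
  have hε₁ : χ₁ ⟨κ, hκ₁⟩ ^ 2 = 1 := by
    rw [← map_pow, show (⟨κ, hκ₁⟩ : Subgroup.centralizer {g₁}) ^ 2 = 1 from Subtype.ext hκ2,
      map_one]
  have hε₂ : χ₂ ⟨κ, hκ₂⟩ ^ 2 = 1 := by
    rw [← map_pow, show (⟨κ, hκ₂⟩ : Subgroup.centralizer {g₂}) ^ 2 = 1 from Subtype.ext hκ2,
      map_one]
  have hχ₃κ : χ₃ κ = 1 := by
    have h := congrArg χ₃ hcomm₁₂
    rw [map_mul, map_mul, map_mul, mul_comm (χ₃ g₂)] at h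
    exact left_eq_mul.1 (h.trans (mul_comm _ _))
  have hχ₁₃ : χ₁ ⟨g₃, hg₃₁⟩ = (χ₃ g₁)⁻¹ := eq_inv_of_mul_eq_one_left (hcompat₁₃ hg₃₁)
  have hχ₂₃ : χ₂ ⟨g₃, hg₃₂⟩ = -(χ₃ g₂)⁻¹ := by
    rw [eq_mul_inv_of_mul_eq (hcompat₂₃ hg₃₂), neg_one_mul]
  have hpq : χ₁ ⟨g₂ ^ 2, hq₁⟩ * χ₂ ⟨g₁ ^ 2, hq₂⟩ = χ₁ ⟨κ, hκ₁⟩ * χ₂ ⟨κ, hκ₂⟩ := by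
    have h : χ₁ (⟨κ, hκ₁⟩ * ⟨g₂ ^ 2, hq₁⟩) * χ₂ (⟨κ, hκ₂⟩ * ⟨g₁ ^ 2, hq₂⟩) = 1 :=
      hcompat₁₂ (Subgroup.mul_mem _ hκ₁ hq₁) (Subgroup.mul_mem _ hκ₂ hq₂)
    rw [map_mul, map_mul, mul_mul_mul_comm] at h
    rw [eq_inv_of_mul_eq_one_right h, inv_eq_iff_mul_eq_one, ← pow_two, mul_pow, hε₁, hε₂,
      one_mul]
  have hg₁a (n : ℤ) : χ₁ ⟨g₁, hg₁₁⟩ ^ (2 * n) = 1 := by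
    rw [hχ₁, (even_two_mul n).neg_one_zpow]
  have hg₂b (n : ℤ) : χ₂ ⟨g₂, hg₂₂⟩ ^ (2 * n) = 1 := by
    rw [hχ₂, (even_two_mul n).neg_one_zpow]
  -- Evaluate the three characters on a relation between the generators.
  have hrel (a b c d : ℤ) (h : g₁ ^ (2 * a) * g₂ ^ (2 * b) * g₃ ^ c * κ ^ d = 1) :
      χ₁ ⟨g₂ ^ 2, hq₁⟩ ^ b * (χ₃ g₁)⁻¹ ^ c * χ₁ ⟨κ, hκ₁⟩ ^ d = 1 ∧
      χ₂ ⟨g₁ ^ 2, hq₂⟩ ^ a * (-(χ₃ g₂)⁻¹) ^ c * χ₂ ⟨κ, hκ₂⟩ ^ d = 1 ∧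
      χ₃ g₁ ^ (2 * a) * χ₃ g₂ ^ (2 * b) * (-1) ^ c = 1 := by
    refine ⟨?_, ?_, ?_⟩
    · have h' : (⟨g₁, hg₁₁⟩ : Subgroup.centralizer {g₁}) ^ (2 * a) * ⟨g₂ ^ 2, hq₁⟩ ^ b *
          ⟨g₃, hg₃₁⟩ ^ c * ⟨κ, hκ₁⟩ ^ d = 1 := by
        apply Subtype.ext
        simpa [zpow_mul g₂] using h
      simpa only [map_mul, map_zpow, hg₁a, one_mul, map_one, hχ₁₃] using congrArg χ₁ h'
    · have h' : (⟨g₁ ^ 2, hq₂⟩ : Subgroup.centralizer {g₂}) ^ a * ⟨g₂, hg₂₂⟩ ^ (2 * b) *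
          ⟨g₃, hg₃₂⟩ ^ c * ⟨κ, hκ₂⟩ ^ d = 1 := by
        apply Subtype.ext
        simpa [zpow_mul g₁] using h
      simpa only [map_mul, map_zpow, hg₂b, mul_one, map_one, hχ₂₃] using congrArg χ₂ h'
    · simpa only [map_mul, map_zpow, hχ₃, hχ₃κ, one_zpow, mul_one, map_one] using congrArg χ₃ h
  set ε₁ := χ₁ ⟨κ, hκ₁⟩
  set ε₂ := χ₂ ⟨κ, hκ₂⟩
  set p := χ₁ ⟨g₂ ^ 2, hq₁⟩
  set q := χ₂ ⟨g₁ ^ 2, hq₂⟩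
  obtain ⟨μ, hμ⟩ : ∃ μ : kˣ, μ ^ 2 = ε₂ * p := by
    obtain ⟨m, hm⟩ := IsAlgClosed.exists_pow_nat_eq ((ε₂ * p : kˣ) : k) two_pos
    have hm0 : m ≠ 0 := by
      rintro rfl
      rw [zero_pow two_ne_zero] at hm
      exact (ε₂ * p).ne_zero hm.symm
    exact ⟨Units.mk0 m hm0, Units.ext (by simpa using hm)⟩
  obtain ⟨E, _, s, x, y, w, z, hinj, hsc, hcen, hxz, hyz, hwz, hxy, hzz, hxw, hyw⟩ :=
    exists_central_extension μ ε₁ ε₂ (χ₃ g₁)⁻¹ (-(χ₃ g₂)⁻¹) hε₁ hε₂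
  rw [hμ] at hzz
  have hscomm (u : kˣ) (v : E) : s u * v = v * s u := (Subgroup.mem_center_iff.1 (hsc u) v).symm
  have hxx : SemiconjBy x x (s 1 * x) := by simp [SemiconjBy]
  have hyy : SemiconjBy y y (s 1 * y) := by simp [SemiconjBy]
  have hww : SemiconjBy w w (s 1 * w) := by simp [SemiconjBy]
  have hwz' : SemiconjBy w z (s 1 * z) := by
    rw [map_one, one_mul]; exact hwz
  have hss (h : E) (u : kˣ) : SemiconjBy h (s u) (s 1 * s u) := by simp [SemiconjBy, hscomm]
  have hxyy : SemiconjBy x (y ^ 2) (s p * y ^ 2) := by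
    have h : x * (y * y) = z * (y * z) * (y * x) := by
      rw [← mul_assoc, hxy, mul_assoc, mul_assoc, hxy]; simp only [mul_assoc]
    rw [SemiconjBy, pow_two, h, hyz.eq, ← mul_assoc z, ← mul_assoc z, ← hscomm, mul_assoc (s ε₂),
      ← pow_two, hzz, ← map_mul, ← mul_assoc ε₂, ← pow_two, hε₂, one_mul]
    simp only [mul_assoc]
  have hyxx : SemiconjBy y (x ^ 2) (s q * x ^ 2) := by
    have h : x ^ 2 * y = s (ε₁ * (ε₂ * p)) * (y * x ^ 2) := by
      have h : x * (x * y) = (x * z) * (y * x) := by rw [hxy, mul_assoc]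
      rw [pow_two, mul_assoc, h, hxz.eq, mul_assoc, mul_assoc, ← mul_assoc x, hxy, map_mul, ← hzz]
      simp only [mul_assoc, pow_two]
    have h' : q * (ε₁ * (ε₂ * p)) = 1 := by
      rw [show q * (ε₁ * (ε₂ * p)) = (p * q) * (ε₁ * ε₂) by ac_rfl, hpq, ← pow_two, mul_pow,
        hε₁, hε₂, one_mul]
    rw [SemiconjBy, mul_assoc, h, ← mul_assoc, ← map_mul, h', map_one, one_mul]
  let P : Subgroup (G × E) := Subgroup.closure {(g₁, x), (g₂, y), (g₃, w)}
  have hP₁ : (g₁, x) ∈ P := Subgroup.subset_closure (by simp)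
  have hP₂ : (g₂, y) ∈ P := Subgroup.subset_closure (by simp)
  have hP₃ : (g₃, w) ∈ P := Subgroup.subset_closure (by simp)
  have hPκ : (κ, z) ∈ P := by
    have h : (κ, z) = (g₁, x) * (g₂, y) * ((g₂, y) * (g₁, x))⁻¹ := by
      rw [eq_mul_inv_iff_mul_eq]
      exact Prod.ext hcomm₁₂.symm hxy.symm
    rw [h]
    exact P.mul_mem (P.mul_mem hP₁ hP₂) (P.inv_mem (P.mul_mem hP₂ hP₁))
  have hsurj : ∀ g, ∃ e, (g, e) ∈ P := by
    have h : P.map (MonoidHom.fst G E) = ⊤ := by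
      rw [MonoidHom.map_closure, ← hgen]
      simp [Set.image_insert_eq]
    intro g
    obtain ⟨⟨_, e⟩, he, rfl⟩ : g ∈ P.map (MonoidHom.fst G E) := h ▸ Subgroup.mem_top g
    exact ⟨e, he⟩
  have hnf : ∀ g e, (g, e) ∈ P → ∃ a b c d : ℤ, ∃ u : kˣ,
      g = g₁ ^ a * g₂ ^ b * g₃ ^ c * κ ^ d ∧ e = x ^ a * y ^ b * w ^ c * z ^ d * s u := by
    intro g e he
    have : s.range.Normal := ⟨by
      rintro _ ⟨u, rfl⟩ v
      exact ⟨u, by rw [← hscomm, mul_inv_cancel_right]⟩⟩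
    let π := QuotientGroup.mk' s.range
    have hπ (u : kˣ) : π (s u) = 1 := (QuotientGroup.eq_one_iff _).2 ⟨u, rfl⟩
    have hcom {a b : E} {u : kˣ} (h : SemiconjBy a b (s u * b)) : Commute (π a) (π b) := by
      have := congrArg π h.eq
      rwa [map_mul, map_mul, map_mul, hπ, one_mul] at this
    have hmem : (g, π e) ∈ Subgroup.closure {(g₁, π x), (g₂, π y), (g₃, π w)} := by
      have h := Subgroup.mem_map_of_mem ((MonoidHom.id G).prodMap π) he
      rw [MonoidHom.map_closure] at h
      simpa [Set.image_insert_eq] using h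
    obtain ⟨a, b, c, d, h⟩ := exists_zpow_of_mem_closure
      (x := (g₁, π x)) (y := (g₂, π y)) (w := (g₃, π w)) (z := (κ, π z))
      (Prod.ext hcomm₁₂ (by simpa using congrArg π hxy))
      (Commute.prod (hκc _) (hcom hxz).symm) (Commute.prod (hκc _) (hcom hyz).symm)
      (Commute.prod (hκc _) (hcom hwz').symm) (Commute.prod (hg₃c _) (hcom hxw).symm)
      (Commute.prod (hg₃c _) (hcom hyw).symm) hmem
    have he : π e = π (x ^ a * y ^ b * w ^ c * z ^ d) := by simpa using congrArg Prod.snd h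
    obtain ⟨u, hu⟩ := QuotientGroup.eq.1 he.symm
    exact ⟨a, b, c, d, u, by simpa using congrArg Prod.fst h, by rw [hu, mul_inv_cancel_left]⟩
  have hker : ∀ e, (1, e) ∈ P → e ∈ Subgroup.center E := by
    intro e he
    obtain ⟨a, b, c, d, u, h1, rfl⟩ := hnf 1 e he
    have hzκ (n : ℤ) (g : G) : Commute (κ ^ n) g := Commute.zpow_left (hκc g) n
    have hz₃ (n : ℤ) (g : G) : Commute (g₃ ^ n) g := Commute.zpow_left (hg₃c g) n
    have ha : Even a := by
      apply even_of_zpow_eq_one hκ1 hκ2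
      have h : Commute g₂ (g₁ ^ a) := by
        rw [mul_assoc, mul_assoc, eq_comm, mul_eq_one_iff_eq_inv] at h1
        rw [h1]
        exact (((Commute.refl g₂).zpow_right b).mul_right
          ((hz₃ c g₂).symm.mul_right (hzκ d g₂).symm)).inv_right
      have h' := (hs₂.zpow_right a).eq
      rwa [Commute.mul_zpow (hκc g₁), h.eq, mul_assoc, right_eq_mul] at h'
    have hb : Even b := by
      apply even_of_zpow_eq_one hκ1 hκ2
      have h : Commute g₁ (g₂ ^ b) := by
        rw [mul_assoc, mul_assoc, eq_comm, mul_eq_one_iff_inv_eq, eq_comm, ← mul_assoc,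
          mul_assoc, ← eq_mul_inv_iff_mul_eq] at h1
        rw [h1]
        exact ((Commute.refl g₁).zpow_right a).inv_right.mul_right
          ((hz₃ c g₁).symm.mul_right (hzκ d g₁).symm).inv_right
      have h' := (hs₁.zpow_right b).eq
      rwa [Commute.mul_zpow (hκc g₂), h.eq, mul_assoc, right_eq_mul] at h'
    obtain ⟨a, rfl⟩ := ha.two_dvd
    obtain ⟨b, rfl⟩ := hb.two_dvd
    obtain ⟨h₁, h₂, h₃⟩ := hrel a b c d h1.symm
    have hc := even_of_relations hpq hε₁ hε₂ h₁ h₂ h₃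
    rw [hc.neg_one_zpow, mul_one] at h₃
    have hpow : x ^ (2 * a) * y ^ (2 * b) * w ^ c * z ^ d * s u =
        (x ^ 2) ^ a * (y ^ 2) ^ b * w ^ c * z ^ d * s u := by
      simp [zpow_mul]
    have hcomb {h : E} {p₁ p₂ p₃ p₄ : kˣ} (k₁ : SemiconjBy h (x ^ 2) (s p₁ * x ^ 2))
        (k₂ : SemiconjBy h (y ^ 2) (s p₂ * y ^ 2)) (k₃ : SemiconjBy h w (s p₃ * w))
        (k₄ : SemiconjBy h z (s p₄ * z)) (hp : p₁ ^ a * p₂ ^ b * p₃ ^ c * p₄ ^ d = 1) :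
        Commute (x ^ (2 * a) * y ^ (2 * b) * w ^ c * z ^ d * s u) h := by
      have := ((((k₁.zpow_scalar hsc a).mul_scalar hsc (k₂.zpow_scalar hsc b)).mul_scalar hsc
        (k₃.zpow_scalar hsc c)).mul_scalar hsc (k₄.zpow_scalar hsc d)).mul_scalar hsc (hss h u)
      rw [hp, mul_one, map_one, one_mul, ← hpow] at this
      exact Commute.symm this
    refine hcen _ (hcomb (hxx.pow_scalar hsc 2) hxyy hxw hxz ?_)
      (hcomb hyxx (hyy.pow_scalar hsc 2) hyw hyz ?_)
      (hcomb (hxw.symm_scalar.pow_scalar hsc 2) (hyw.symm_scalar.pow_scalar hsc 2) hww hwz' ?_)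
    · simpa using h₁
    · simpa using h₂
    · rw [← zpow_natCast, ← zpow_natCast, ← zpow_mul, ← zpow_mul, Nat.cast_ofNat, inv_inv, inv_neg,
        inv_inv, (even_two_mul b).neg_zpow]
      simpa using h₃
  obtain ⟨r, hr⟩ := exists_retraction_of_units (A := Subgroup.center E)
    (s.codRestrict (Subgroup.center E) hsc) fun u v huv => hinj (congrArg Subtype.val huv)
  obtain ⟨σ, hσ, hσc⟩ := exists_cocycle_of_lift P hsurj hker r
  refine ⟨σ, hσ, fun _ => ?_, fun _ => ?_, ?_⟩
  · rw [hσc g₁ κ x z hP₁ hPκ (hκc g₁).symm (s.codRestrict _ hsc ε₁)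
      (hxz.eq.trans (mul_assoc _ _ _)), hr, ← pow_two, hε₁]
  · rw [hσc g₂ κ y z hP₂ hPκ (hκc g₂).symm (s.codRestrict _ hsc ε₂)
      (hyz.eq.trans (mul_assoc _ _ _)), hr, ← pow_two, hε₂]
  · rw [hσc g₃ κ w z hP₃ hPκ (hκc g₃).symm 1 (by simpa using hwz.eq), map_one, hχ₃κ, one_mul]
end
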